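/- arXiv:1501.07377 — 2 statements merged into one kernel-verified Lean document; each statement's English description precedes it below -/
import Mathlib

section
/- Let N ≥ 2, let p = (p_1,…,p_s) consist of s distinct primes, for each j ∈ {1,…,s} let m_j ∈ ℕ be minimal such that N < p_j^{m_j}, and let γ = (γ_j)_{j≥1} be a non-increasing sequence of weights with 1 ≥ γ_1 ≥ γ_2 ≥ … > 0. Then there exists a shift σ = (σ_1,…,σ_s) belonging to the finite set ℚ(p_1^{m_1}) × ⋯ × ℚ(p_s^{m_s}) such that e²_{N,s}(H_{p,N} ⊕^{simi} σ) ≤ (1/N²) [ Π_{j=1}^s (1 + 2γ_j (log N) p_j²/log p_j) + Π_{j=1}^s (1 + γ_j) · Π_{j=1}^s (1 + γ_j p_j/6) ]. -/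
open MeasureTheory Finset

/-- The digit of `x ∈ [0,1)` at base-`p` position `r` (the coefficient of `p^{-(r+1)}`),
using the finite expansion for `p`-adic rationals. -/
noncomputable def rdigit (p : ℕ) (x : ℝ) (r : ℕ) : ℕ :=
  (⌊x * (p : ℝ) ^ (r + 1)⌋).toNat % p

/-- The value of the `p`-adic integer `φ_p^+(x)` modulo `p^m`, as a natural number. -/
noncomputable def truncVal (p : ℕ) (x : ℝ) (m : ℕ) : ℕ :=
  ∑ r ∈ Finset.range m, rdigit p x r * p ^ r

/-- Digit `r` of the `p`-adic sum `φ_p^+(x) +_{ℤ_p} φ_p^+(σ)`. -/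
noncomputable def sdigit (p : ℕ) (x σ : ℝ) (r : ℕ) : ℕ :=
  (truncVal p x (r + 1) + truncVal p σ (r + 1)) % p ^ (r + 1) / p ^ r

/-- The `p`-adic shift `x ⊕_p σ = φ_p(φ_p^+(x) +_{ℤ_p} φ_p^+(σ))` (the Monna map applied to
the `p`-adic sum, taken mod 1). -/
noncomputable def pshift (p : ℕ) (x σ : ℝ) : ℝ :=
  Int.fract (∑' r : ℕ, (sdigit p x σ r : ℝ) / (p : ℝ) ^ (r + 1))

/-- The simplified `p`-adic shift `x ⊕_{p,m}^{simp} σ`: the truncation of `x ⊕_p σ` to its `m`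
most significant base-`p` digits. -/
noncomputable def simpShift (p m : ℕ) (x σ : ℝ) : ℝ :=
  ∑ r ∈ Finset.range m, (sdigit p x σ r : ℝ) / (p : ℝ) ^ (r + 1)

/-- The mid-simplified `p`-adic shift `x ⊕_{p,m}^{simi} σ = (x ⊕_{p,m}^{simp} σ) + 1/(2p^m)`. -/
noncomputable def midShift (p m : ℕ) (x σ : ℝ) : ℝ :=
  simpShift p m x σ + 1 / (2 * (p : ℝ) ^ m)

/-- The radical inverse function `φ_p(n) = Σ_r n_r p^{-(r+1)}` in base `p`. -/
noncomputable def radInv (p n : ℕ) : ℝ :=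
  ∑' r : ℕ, ((n / p ^ r % p : ℕ) : ℝ) / (p : ℝ) ^ (r + 1)

/-- Membership in `ℚ(p^m) = {a p^{-m} : a = 0,1,…,p^m - 1}`. -/
def QSet (p m : ℕ) (x : ℝ) : Prop :=
  ∃ a : ℕ, a < p ^ m ∧ x = (a : ℝ) / (p : ℝ) ^ m

/-- The squared worst-case error of the QMC rule based on the `N`-element point set
`P ⊆ [0,1)^d` in the weighted anchored Sobolev space with weights `γ` (0-indexed, so the
paper's `γ_j` is `γ (j-1)`). -/
noncomputable def sqErr (d N : ℕ) (γ : ℕ → ℝ) (P : Fin N → Fin d → ℝ) : ℝ :=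
  (∏ j : Fin d, (1 + γ j.val / 3))
    - 2 / (N : ℝ) * ∑ n : Fin N, ∏ j : Fin d, (1 + γ j.val / 2 * (1 - P n j ^ 2))
    + 1 / (N : ℝ) ^ 2 *
        ∑ n : Fin N, ∑ h : Fin N, ∏ j : Fin d, (1 + γ j.val * min (1 - P n j) (1 - P h j))

/-- The radical inverse of `z` in base `p`, truncated to its `m` most significant digits. -/
noncomputable def truncRadInv (p m z : ℕ) : ℝ :=
  ∑ r ∈ Finset.range m, ((z / p ^ r % p : ℕ) : ℝ) / (p : ℝ) ^ (r + 1)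

lemma truncRadInv_zero (p z : ℕ) : truncRadInv p 0 z = 0 := by
  simp [truncRadInv]

lemma truncRadInv_succ (p m z : ℕ) :
    truncRadInv p (m + 1) z = (((z % p : ℕ) : ℝ) + truncRadInv p m (z / p)) / p := by
  rw [truncRadInv, Finset.sum_range_succ', truncRadInv, add_div, Finset.sum_div, add_comm]
  congr 1
  · simp
  · refine Finset.sum_congr rfl fun r _ => ?_
    rw [Nat.div_div_eq_div_mul, ← pow_succ', div_div, ← pow_succ]

lemma truncRadInv_nonneg (p m z : ℕ) : 0 ≤ truncRadInv p m z :=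
  Finset.sum_nonneg fun _ _ => by positivity

lemma truncRadInv_lt_one {p : ℕ} (hp : 0 < p) (m z : ℕ) : truncRadInv p m z < 1 := by
  induction m generalizing z with
  | zero => simp [truncRadInv_zero]
  | succ m ih =>
    have hp' : (0 : ℝ) < p := by exact_mod_cast hp
    have h : ((z % p : ℕ) : ℝ) + 1 ≤ p := by exact_mod_cast Nat.mod_lt z hp
    rw [truncRadInv_succ, div_lt_one hp']
    linarith [ih (z / p)]

lemma truncRadInv_add_pow (p m z : ℕ) : truncRadInv p m (z + p ^ m) = truncRadInv p m z := by
  induction m generalizing z with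
  | zero => simp [truncRadInv_zero]
  | succ m ih =>
    rcases Nat.eq_zero_or_pos p with rfl | hp
    · simp
    · rw [truncRadInv_succ, truncRadInv_succ, pow_succ, Nat.add_mul_mod_self_right,
        Nat.add_mul_div_right _ _ hp, ih]

lemma rdigit_truncRadInv {p : ℕ} (hp : 0 < p) {m r : ℕ} (hr : r < m) (z : ℕ) :
    rdigit p (truncRadInv p m z) r = z / p ^ r % p := by
  have hp' : (p : ℝ) ≠ 0 := by exact_mod_cast hp.ne'
  induction r generalizing m z with
  | zero =>
    obtain ⟨m, rfl⟩ := Nat.exists_eq_succ_of_ne_zero hr.ne'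
    have h : ⌊((z % p : ℕ) : ℝ) + truncRadInv p m (z / p)⌋ = ((z % p : ℕ) : ℤ) := by
      rw [Int.floor_eq_iff, Int.cast_natCast]
      exact ⟨by linarith [truncRadInv_nonneg p m (z / p)],
        by linarith [truncRadInv_lt_one hp m (z / p)]⟩
    rw [rdigit, truncRadInv_succ, zero_add, pow_one, div_mul_cancel₀ _ hp', h,
      Int.toNat_natCast, Nat.mod_mod, pow_zero, Nat.div_one]
  | succ r ih =>
    obtain ⟨m, rfl⟩ := Nat.exists_eq_succ_of_ne_zero (Nat.ne_of_gt (Nat.zero_lt_of_lt hr))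
    have h := ih (Nat.lt_of_succ_lt_succ hr) (z / p)
    rw [Nat.div_div_eq_div_mul, ← pow_succ'] at h
    rw [← h, rdigit, rdigit, truncRadInv_succ]
    have h2 : (((z % p : ℕ) : ℝ) + truncRadInv p m (z / p)) / p * (p : ℝ) ^ (r + 1 + 1)
        = ((z % p * p ^ (r + 1) : ℕ) : ℝ) + truncRadInv p m (z / p) * (p : ℝ) ^ (r + 1) := by
      push_cast
      field_simp
      ring
    have h3 : 0 ≤ ⌊truncRadInv p m (z / p) * (p : ℝ) ^ (r + 1)⌋ :=
      Int.floor_nonneg.2 (mul_nonneg (truncRadInv_nonneg _ _ _) (by positivity))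
    rw [h2, Int.floor_natCast_add, Int.toNat_add (by positivity) h3, Int.toNat_natCast,
      pow_succ, ← mul_assoc, Nat.mul_add_mod_self_right]

lemma truncVal_truncRadInv {p : ℕ} (hp : 0 < p) {m k : ℕ} (hk : k ≤ m) (z : ℕ) :
    truncVal p (truncRadInv p m z) k = z % p ^ k := by
  induction k with
  | zero => simp [truncVal, Nat.mod_one]
  | succ k ih =>
    have h := ih (Nat.le_of_succ_le hk)
    rw [truncVal] at h ⊢
    rw [Finset.sum_range_succ, h, rdigit_truncRadInv hp hk, Nat.mod_pow_succ, mul_comm (p ^ k)]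

lemma simpShift_truncRadInv {p : ℕ} (hp : 0 < p) (m n t : ℕ) :
    simpShift p m (truncRadInv p m n) (truncRadInv p m t) = truncRadInv p m (n + t) := by
  refine Finset.sum_congr rfl fun r hr => ?_
  have hr' : r + 1 ≤ m := Finset.mem_range.1 hr
  rw [sdigit, truncVal_truncRadInv hp hr', truncVal_truncRadInv hp hr', ← Nat.add_mod,
    pow_succ, Nat.mod_mul_right_div_self]

lemma radInv_eq_truncRadInv {p m n : ℕ} (hn : n < p ^ m) :
    radInv p n = truncRadInv p m n := by
  refine tsum_eq_sum fun r hr => ?_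
  have hr' : m ≤ r := by simpa using hr
  rcases Nat.eq_zero_or_pos p with rfl | hp
  · simp
  · rw [Nat.div_eq_of_lt (hn.trans_le (Nat.pow_le_pow_right hp hr'))]
    simp

lemma qSet_truncRadInv {p : ℕ} (hp : 0 < p) (m z : ℕ) : QSet p m (truncRadInv p m z) := by
  have hp' : (0 : ℝ) < p := by exact_mod_cast hp
  induction m generalizing z with
  | zero => exact ⟨0, by simp, by simp [truncRadInv_zero]⟩
  | succ m ih =>
    obtain ⟨a, ha, h⟩ := ih (z / p)
    refine ⟨z % p * p ^ m + a, ?_, ?_⟩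
    · have h1 : (z % p + 1) * p ^ m ≤ p * p ^ m := Nat.mul_le_mul_right _ (Nat.mod_lt z hp)
      rw [pow_succ']
      linarith
    · rw [truncRadInv_succ, h]
      push_cast
      field_simp
      ring

lemma sum_range_mul_digits (p M : ℕ) (f : ℕ → ℝ) :
    ∑ x ∈ range (p * M), f x = ∑ i ∈ range p, ∑ t ∈ range M, f (i + p * t) := by
  induction M with
  | zero => simp
  | succ M ih =>
    rw [Nat.mul_succ, Finset.sum_range_add, ih, ← Finset.sum_add_distrib]
    refine Finset.sum_congr rfl fun i _ => ?_
    rw [Finset.sum_range_succ, add_comm i (p * M)]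

lemma sum_range_add_of_periodic {Q : ℕ} {f : ℕ → ℝ} (hf : ∀ x, f (x + Q) = f x) (n : ℕ) :
    ∑ x ∈ range Q, f (n + x) = ∑ x ∈ range Q, f x := by
  induction n with
  | zero => simp
  | succ n ih =>
    have h := Finset.sum_range_succ (fun x => f (n + x)) Q
    rw [Finset.sum_range_succ' (fun x => f (n + x)), hf, ih] at h
    simp only [add_zero, add_left_inj] at h
    rw [← h]
    exact Finset.sum_congr rfl fun x _ => by congr 1; ring

lemma sum_range_of_periodic {Q : ℕ} {f : ℕ → ℝ} (hf : ∀ x, f (x + Q) = f x)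
    (h0 : ∑ x ∈ range Q, f x = 0) (N : ℕ) :
    ∑ x ∈ range N, f x = ∑ x ∈ range (N % Q), f x := by
  have hmul : ∀ k x, f (Q * k + x) = f x := by
    intro k x
    induction k with
    | zero => simp
    | succ k ih => rw [← ih, ← hf (Q * k + x)]; congr 1; ring
  have hz : ∀ k, ∑ x ∈ range (Q * k), f x = 0 := by
    intro k
    induction k with
    | zero => simp
    | succ k ih => rw [Nat.mul_succ, Finset.sum_range_add, ih]; simp [hmul, h0]
  conv_lhs => rw [← Nat.div_add_mod N Q, Finset.sum_range_add, hz]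
  simp [hmul]

lemma sum_truncRadInv {p : ℕ} (hp : 0 < p) (m : ℕ) (f : ℝ → ℝ) (n : ℕ) :
    ∑ t ∈ range (p ^ m), f (truncRadInv p m (n + t)) =
      ∑ a ∈ range (p ^ m), f ((a : ℝ) / (p : ℝ) ^ m) := by
  have hp' : (p : ℝ) ≠ 0 := by exact_mod_cast hp.ne'
  rw [sum_range_add_of_periodic (f := fun x => f (truncRadInv p m x))
    fun x => by rw [truncRadInv_add_pow]]
  induction m generalizing f with
  | zero => simp [truncRadInv_zero]
  | succ m ih =>
    rw [pow_succ', sum_range_mul_digits, mul_comm p, sum_range_mul_digits, Finset.sum_comm]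
    conv_rhs => rw [Finset.sum_comm]
    rw [Finset.sum_comm]
    refine Finset.sum_congr rfl fun i hi => ?_
    have hi' := Finset.mem_range.1 hi
    have h := ih fun x => f ((i + x) / p)
    calc ∑ t ∈ range (p ^ m), f (truncRadInv p (m + 1) (i + p * t))
        = ∑ t ∈ range (p ^ m), f ((i + truncRadInv p m t) / p) := by
          refine Finset.sum_congr rfl fun t _ => ?_
          rw [truncRadInv_succ, Nat.add_mul_mod_self_left, Nat.mod_eq_of_lt hi',
            Nat.add_mul_div_left _ _ hp, Nat.div_eq_of_lt hi', zero_add]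
      _ = _ := by
          rw [h]
          refine Finset.sum_congr rfl fun a _ => ?_
          congr 1
          push_cast
          field_simp
          ring

lemma sum_mod_add {p : ℕ} (n : ℕ) (f : ℕ → ℝ) :
    ∑ i ∈ range p, f ((n + i) % p) = ∑ i ∈ range p, f i := by
  rw [sum_range_add_of_periodic (f := fun x => f (x % p)) fun x => by rw [Nat.add_mod_right]]
  exact Finset.sum_congr rfl fun i hi => by rw [Nat.mod_eq_of_lt (Finset.mem_range.1 hi)]

lemma sum_abs_mod_sub {p : ℕ} (hp : 0 < p) (n h : ℕ) :
    ∑ i ∈ range p, |(((n + i) % p : ℕ) : ℝ) - (((h + i) % p : ℕ) : ℝ)| =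
      2 * (((n - h : ℤ) % p : ℤ) : ℝ) * (p - (((n - h : ℤ) % p : ℤ) : ℝ)) := by
  have hpz : (0 : ℤ) < p := by exact_mod_cast hp
  have hp' : (0 : ℝ) < p := by exact_mod_cast hp
  obtain ⟨c, hc⟩ : ∃ c : ℤ, c = (n - h : ℤ) % p := ⟨_, rfl⟩
  have hc0 : 0 ≤ c := hc ▸ Int.emod_nonneg _ hpz.ne'
  have hcp : c < p := hc ▸ Int.emod_lt_of_pos _ hpz
  have hc0' : (0 : ℝ) ≤ c := by exact_mod_cast hc0
  have hcp' : (c : ℝ) < p := by exact_mod_cast hcp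
  rw [← hc]
  have key : ∀ i ∈ range p, |(((n + i) % p : ℕ) : ℝ) - (((h + i) % p : ℕ) : ℝ)| =
      c + ((((n + i) % p : ℕ) : ℝ) - (((h + i) % p : ℕ) : ℝ) - c) * ((2 * c - p) / p) := by
    intro i _
    have hx := Nat.mod_lt (n + i) hp
    have hy := Nat.mod_lt (h + i) hp
    have hmod : (((n + i) % p : ℕ) - ((h + i) % p : ℕ) : ℤ) % p = c := by
      rw [hc]
      push_cast
      rw [← Int.sub_emod]
      congr 1
      ring
    generalize (n + i) % p = x at *
    generalize (h + i) % p = y at *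
    rcases le_or_gt y x with hxy | hxy
    · rw [Int.emod_eq_of_lt (by omega) (by omega)] at hmod
      have hu : (x : ℝ) - y = c := by exact_mod_cast hmod
      rw [hu, abs_of_nonneg hc0']
      ring
    · rw [← Int.add_emod_right, Int.emod_eq_of_lt (by omega) (by omega)] at hmod
      have hu : (x : ℝ) - y = c - p := by
        have h1 : (x : ℝ) - y + p = c := by exact_mod_cast hmod
        linarith
      rw [hu, abs_of_nonpos (by linarith)]
      field_simp
      ring
  rw [Finset.sum_congr rfl key, Finset.sum_add_distrib, ← Finset.sum_mul,
    Finset.sum_sub_distrib, Finset.sum_sub_distrib, sum_mod_add n (fun x => (x : ℝ)),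
    sum_mod_add h (fun x => (x : ℝ))]
  simp only [sum_const, card_range, nsmul_eq_mul, sub_self, zero_sub]
  field_simp
  ring

lemma sum_truncRadInv_sub {p : ℕ} (hp : 0 < p) (m n h : ℕ) :
    ∑ t ∈ range (p ^ m), (truncRadInv p m (n + t) - truncRadInv p m (h + t)) = 0 := by
  rw [Finset.sum_sub_distrib, sum_truncRadInv hp m (fun x => x), sum_truncRadInv hp m (fun x => x),
    sub_self]

lemma sum_abs_intCast_add {p : ℕ} (hp : 0 < p) (m n h : ℕ) {z : ℤ} (hz : z ≠ 0) :
    ∑ t ∈ range (p ^ m), |(z : ℝ) + (truncRadInv p m (n + t) - truncRadInv p m (h + t))| =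
      (p : ℝ) ^ m * |(z : ℝ)| := by
  have h0 := sum_truncRadInv_sub hp m n h
  rcases lt_or_gt_of_ne hz with hz | hz
  · have hz' : (z : ℝ) ≤ -1 := by exact_mod_cast Int.le_sub_one_of_lt hz
    rw [Finset.sum_congr rfl fun t _ => abs_of_nonpos (a := (z : ℝ) + _) (by
      linarith [truncRadInv_lt_one hp m (n + t), truncRadInv_nonneg p m (h + t)]),
      Finset.sum_neg_distrib, Finset.sum_add_distrib, h0, abs_of_nonpos (by linarith)]
    simp
  · have hz' : (1 : ℝ) ≤ z := by exact_mod_cast hz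
    rw [Finset.sum_congr rfl fun t _ => abs_of_nonneg (a := (z : ℝ) + _) (by
      linarith [truncRadInv_lt_one hp m (h + t), truncRadInv_nonneg p m (n + t)]),
      Finset.sum_add_distrib, h0, abs_of_nonneg (by linarith)]
    simp

/-- Half the mean distance of two independent uniform points of the grid `ℚ(p^l)`. -/
noncomputable def gridMean (p l : ℕ) : ℝ := (1 - 1 / (p : ℝ) ^ (2 * l)) / 6

/-- The mean-zero part of the shift-averaged kernel which depends on the lowest digit of `d`. -/
noncomputable def digitKernel (p l : ℕ) (d : ℤ) : ℝ :=
  gridMean p (l + 1) - ((d % p : ℤ) : ℝ) * (p - ((d % p : ℤ) : ℝ)) / (p : ℝ) ^ 2 -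
    if (p : ℤ) ∣ d then gridMean p l / p else 0

/-- The mean-zero part of the shift-averaged kernel which depends on digit `a` of `d`. -/
noncomputable def levelKernel (p m a : ℕ) (d : ℤ) : ℝ :=
  if (p : ℤ) ^ a ∣ d then digitKernel p (m - 1 - a) (d / (p : ℤ) ^ a) / (p : ℝ) ^ a else 0

lemma levelKernel_succ_zero (p m : ℕ) (d : ℤ) :
    levelKernel p (m + 1) 0 d = digitKernel p m d := by
  simp [levelKernel]

lemma levelKernel_succ_succ {p : ℕ} (hp : 0 < p) (m a : ℕ) (d : ℤ) :
    levelKernel p (m + 1) (a + 1) d =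
      if (p : ℤ) ∣ d then levelKernel p m a (d / p) / p else 0 := by
  have hpz : (p : ℤ) ≠ 0 := by exact_mod_cast hp.ne'
  have hsub : m + 1 - 1 - (a + 1) = m - 1 - a := by omega
  rw [levelKernel, hsub]
  by_cases hd : (p : ℤ) ∣ d
  · obtain ⟨e, rfl⟩ := hd
    rw [if_pos (dvd_mul_right _ _), Int.mul_ediv_cancel_left _ hpz, pow_succ', levelKernel,
      Int.mul_ediv_mul_of_pos _ _ (by positivity), pow_succ]
    simp only [mul_dvd_mul_iff_left hpz]
    split_ifs <;> simp [div_div]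
  · rw [if_neg hd, if_neg fun h => hd ((dvd_pow_self _ (Nat.succ_ne_zero a)).trans h)]

lemma sum_abs_truncRadInv_sub {p : ℕ} (hp : 0 < p) (m n h : ℕ) :
    ∑ t ∈ range (p ^ m), |truncRadInv p m (n + t) - truncRadInv p m (h + t)| =
      (p : ℝ) ^ m *
        (2 * (gridMean p m - ∑ a ∈ range m, levelKernel p m a ((n : ℤ) - h))) := by
  have hpz : (0 : ℤ) < p := by exact_mod_cast hp
  have hp' : (0 : ℝ) < p := by exact_mod_cast hp
  induction m generalizing n h with
  | zero => simp [truncRadInv_zero, gridMean]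
  | succ m ih =>
    have step : ∀ i t, truncRadInv p (m + 1) (n + (i + p * t)) -
        truncRadInv p (m + 1) (h + (i + p * t)) =
        (((((n + i) % p : ℕ) : ℤ) - (((h + i) % p : ℕ) : ℤ) : ℤ) +
          (truncRadInv p m ((n + i) / p + t) - truncRadInv p m ((h + i) / p + t))) / p := by
      intro i t
      rw [truncRadInv_succ, truncRadInv_succ, ← add_assoc, ← add_assoc,
        Nat.add_mul_mod_self_left, Nat.add_mul_mod_self_left, Nat.add_mul_div_left _ _ hp,
        Nat.add_mul_div_left _ _ hp, Int.cast_sub, Int.cast_natCast, Int.cast_natCast]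
      ring
    rw [pow_succ', sum_range_mul_digits, Finset.sum_range_succ', levelKernel_succ_zero]
    simp only [step, abs_div, abs_of_pos hp', levelKernel_succ_succ hp, ← Finset.sum_div]
    by_cases hd : (p : ℤ) ∣ (n : ℤ) - h
    · simp only [hd, if_true, digitKernel, Int.emod_eq_zero_of_dvd hd, ← Finset.sum_div]
      have hi : ∀ i ∈ range p, ∑ t ∈ range (p ^ m),
          |((((((n + i) % p : ℕ) : ℤ) - (((h + i) % p : ℕ) : ℤ) : ℤ)) : ℝ) +
          (truncRadInv p m ((n + i) / p + t) - truncRadInv p m ((h + i) / p + t))| =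
          (p : ℝ) ^ m *
            (2 * (gridMean p m - ∑ a ∈ range m, levelKernel p m a (((n : ℤ) - h) / p))) := by
        intro i _
        have hmod : (((n + i) % p : ℕ) : ℤ) - (((h + i) % p : ℕ) : ℤ) = 0 := by
          push_cast
          rw [sub_eq_zero, Int.emod_eq_emod_iff_emod_sub_eq_zero, add_sub_add_right_eq_sub]
          exact Int.emod_eq_zero_of_dvd hd
        have hdiv : ((((n + i) / p : ℕ) : ℤ)) - (((h + i) / p : ℕ) : ℤ) = ((n : ℤ) - h) / p := by
          obtain ⟨e, he⟩ := hd
          have hn : (n : ℤ) + i = h + i + p * e := by linarith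
          push_cast
          rw [he, hn, Int.add_mul_ediv_left _ _ hpz.ne', Int.mul_ediv_cancel_left _ hpz.ne']
          ring
        simp only [hmod, Int.cast_zero, zero_add]
        rw [ih, hdiv]
      rw [Finset.sum_congr rfl hi]
      simp only [sum_const, card_range, nsmul_eq_mul]
      field_simp
      simp only [Int.cast_zero]
      ring
    · have hi : ∀ i ∈ range p, ∑ t ∈ range (p ^ m),
          |((((((n + i) % p : ℕ) : ℤ) - (((h + i) % p : ℕ) : ℤ) : ℤ)) : ℝ) +
          (truncRadInv p m ((n + i) / p + t) - truncRadInv p m ((h + i) / p + t))| =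
          (p : ℝ) ^ m * |(((n + i) % p : ℕ) : ℝ) - (((h + i) % p : ℕ) : ℝ)| := by
        intro i _
        rw [sum_abs_intCast_add hp]
        · push_cast
          rfl
        · intro h0
          apply hd
          have h1 : ((n : ℤ) + i) % p = (h + i) % p := by
            push_cast at h0
            linarith
          have h2 := Int.emod_eq_emod_iff_emod_sub_eq_zero.1 h1
          simpa using Int.dvd_of_emod_eq_zero h2
      rw [Finset.sum_congr rfl hi, ← Finset.mul_sum, sum_abs_mod_sub hp]
      simp only [hd, if_false, digitKernel, Finset.sum_const_zero]
      field_simp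
      ring

lemma gridMean_nonneg {p : ℕ} (hp : 0 < p) (l : ℕ) : 0 ≤ gridMean p l := by
  have h1 : (1 : ℝ) ≤ (p : ℝ) ^ (2 * l) := one_le_pow₀ (by exact_mod_cast hp)
  have h2 : 1 / (p : ℝ) ^ (2 * l) ≤ 1 := by rw [div_le_one (by positivity)]; exact h1
  rw [gridMean]
  linarith

lemma gridMean_le (p l : ℕ) : gridMean p l ≤ 1 / 6 := by
  have : 0 ≤ 1 / (p : ℝ) ^ (2 * l) := by positivity
  rw [gridMean]
  linarith

lemma abs_digitKernel_le {p : ℕ} (hp : 0 < p) (l : ℕ) (d : ℤ) :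
    |digitKernel p l d| ≤ 1 / 4 := by
  have hpz : (0 : ℤ) < p := by exact_mod_cast hp
  have hp' : (0 : ℝ) < p := by exact_mod_cast hp
  have hp1 : (1 : ℝ) ≤ p := by exact_mod_cast hp
  have hA := gridMean_nonneg hp (l + 1)
  have hA' := gridMean_le p (l + 1)
  rw [digitKernel]
  split_ifs with hd
  · have hB : 0 ≤ gridMean p l / p := div_nonneg (gridMean_nonneg hp l) hp'.le
    have hB' : gridMean p l / p ≤ 1 / 6 :=
      (div_le_self (gridMean_nonneg hp l) hp1).trans (gridMean_le p l)
    rw [Int.emod_eq_zero_of_dvd hd, abs_le]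
    constructor <;> simp <;> linarith
  · have hc0 : (0 : ℝ) ≤ ((d % p : ℤ) : ℝ) := by exact_mod_cast Int.emod_nonneg _ hpz.ne'
    have hcp : ((d % p : ℤ) : ℝ) ≤ p := by exact_mod_cast (Int.emod_lt_of_pos d hpz).le
    generalize ((d % p : ℤ) : ℝ) = c at *
    have hw : 0 ≤ c * (p - c) / (p : ℝ) ^ 2 :=
      div_nonneg (mul_nonneg hc0 (by linarith)) (by positivity)
    have hw' : c * (p - c) / (p : ℝ) ^ 2 ≤ 1 / 4 := by
      rw [div_le_iff₀ (by positivity)]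
      nlinarith [sq_nonneg (2 * c - p)]
    rw [abs_le]
    constructor <;> linarith

lemma abs_levelKernel_le {p : ℕ} (hp : 0 < p) (m a : ℕ) (d : ℤ) :
    |levelKernel p m a d| ≤ if (p : ℤ) ^ a ∣ d then 1 / 4 / (p : ℝ) ^ a else 0 := by
  rw [levelKernel]
  split_ifs
  · rw [abs_div, abs_of_nonneg (by positivity : (0 : ℝ) ≤ (p : ℝ) ^ a)]
    gcongr
    exact abs_digitKernel_le hp _ _
  · simp

lemma digitKernel_eq_of_emod_eq {p : ℕ} (l : ℕ) {d e : ℤ} (h : d % p = e % p) :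
    digitKernel p l d = digitKernel p l e := by
  simp only [digitKernel, h, Int.dvd_iff_emod_eq_zero]

lemma levelKernel_add_mul {p : ℕ} (hp : 0 < p) (m a : ℕ) (d k : ℤ) :
    levelKernel p m a (d + (p : ℤ) ^ (a + 1) * k) = levelKernel p m a d := by
  have hpz : (p : ℤ) ^ a ≠ 0 := by positivity
  have h : d + (p : ℤ) ^ (a + 1) * k = d + (p : ℤ) ^ a * (p * k) := by ring
  rw [levelKernel, levelKernel, h, Int.add_mul_ediv_left _ _ hpz,
    digitKernel_eq_of_emod_eq _ (Int.add_mul_emod_self_left _ _ _)]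
  simp only [dvd_add_left (dvd_mul_right ((p : ℤ) ^ a) (p * k))]

lemma sum_range_mul_sub (n : ℕ) (q : ℝ) :
    ∑ i ∈ range n, (i : ℝ) * (q - i) = q * n * (n - 1) / 2 - n * (n - 1) * (2 * n - 1) / 6 := by
  induction n with
  | zero => simp
  | succ n ih => rw [Finset.sum_range_succ, ih]; push_cast; ring

lemma sum_digitKernel_range {p : ℕ} (hp : 0 < p) (l : ℕ) :
    ∑ i ∈ range p, digitKernel p l (i : ℤ) = 0 := by
  have hp' : (p : ℝ) ≠ 0 := by exact_mod_cast hp.ne'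
  have h : ∀ i ∈ range p, digitKernel p l (i : ℤ) = gridMean p (l + 1) -
      (i : ℝ) * (p - i) / (p : ℝ) ^ 2 - if i = 0 then gridMean p l / p else 0 := by
    intro i hi
    have hip := Finset.mem_range.1 hi
    have hm : ((i : ℤ) % p) = i := by exact_mod_cast Nat.mod_eq_of_lt hip
    have hdvd : (p : ℤ) ∣ i ↔ i = 0 := by
      rw [Int.natCast_dvd_natCast]
      exact ⟨fun h => Nat.eq_zero_of_dvd_of_lt h hip, fun h => h ▸ dvd_zero _⟩
    simp only [digitKernel, hm, hdvd, Int.cast_natCast]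
  rw [Finset.sum_congr rfl h, Finset.sum_sub_distrib, Finset.sum_sub_distrib, ← Finset.sum_div,
    sum_range_mul_sub, Finset.sum_ite_eq' (range p), if_pos (Finset.mem_range.2 hp)]
  simp only [sum_const, card_range, nsmul_eq_mul, gridMean]
  field_simp
  ring

lemma sum_digitKernel_add_mul {p : ℕ} (hp : 0 < p) (l : ℕ) (e : ℤ) {u : ℤ}
    (hu : IsCoprime (p : ℤ) u) :
    ∑ i ∈ range p, digitKernel p l (e + i * u) = 0 := by
  have hpz : (0 : ℤ) < p := by exact_mod_cast hp
  have hcast : ∀ i : ℕ, ((((e + i * u) % p).toNat : ℕ) : ℤ) = (e + i * u) % p := fun i =>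
    Int.toNat_of_nonneg (Int.emod_nonneg _ hpz.ne')
  have hinj : Set.InjOn (fun i : ℕ => ((e + i * u) % p).toNat) (range p : Set ℕ) := by
    intro i hi j hj hij
    have h1 : (e + i * u) % p = (e + j * u) % p := by
      rw [← hcast i, ← hcast j]
      exact congrArg (Nat.cast : ℕ → ℤ) hij
    have h2 : (p : ℤ) ∣ ((i : ℤ) - j) * u := by
      have := Int.dvd_of_emod_eq_zero (Int.emod_eq_emod_iff_emod_sub_eq_zero.1 h1)
      convert this using 1
      ring
    have h3 := hu.dvd_of_dvd_mul_right h2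
    have hi' : i < p := by simpa using hi
    have hj' : j < p := by simpa using hj
    have h4 := Int.eq_zero_of_abs_lt_dvd h3 (by rw [abs_lt]; constructor <;> omega)
    omega
  have himage : (range p).image (fun i : ℕ => ((e + i * u) % p).toNat) = range p := by
    refine Finset.eq_of_subset_of_card_le ?_ ?_
    · intro x hx
      obtain ⟨i, _, rfl⟩ := Finset.mem_image.1 hx
      have := Int.emod_lt_of_pos (e + i * u) hpz
      have h := hcast i
      rw [Finset.mem_range]
      omega
    · rw [Finset.card_image_of_injOn hinj]
  rw [← sum_digitKernel_range hp l]
  conv_rhs => rw [← himage, Finset.sum_image hinj]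
  refine Finset.sum_congr rfl fun i _ => digitKernel_eq_of_emod_eq _ ?_
  rw [hcast, Int.emod_emod_of_dvd _ dvd_rfl]

lemma sum_levelKernel_add_mul {p : ℕ} (hp : 0 < p) (m a : ℕ) (d : ℤ) {u : ℤ}
    (hu : IsCoprime (p : ℤ) u) :
    ∑ i ∈ range p, levelKernel p m a (d + i * ((p : ℤ) ^ a * u)) = 0 := by
  have hpz : (p : ℤ) ^ a ≠ 0 := by positivity
  have h : ∀ i : ℕ, d + i * ((p : ℤ) ^ a * u) = d + (p : ℤ) ^ a * (i * u) := fun i => by ring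
  simp only [h, levelKernel, dvd_add_left (dvd_mul_right ((p : ℤ) ^ a) _),
    Int.add_mul_ediv_left _ _ hpz]
  split_ifs
  · rw [← Finset.sum_div, sum_digitKernel_add_mul hp _ _ hu, zero_div]
  · simp

lemma sum_sum_sub_of_periodic {Q : ℕ} {G : ℤ → ℝ} (hper : ∀ d, G (d + Q) = G d)
    (h0 : ∀ z : ℤ, ∑ x ∈ range Q, G (z + x) = 0) (N : ℕ) :
    ∑ n ∈ range N, ∑ h ∈ range N, G (n - h) =
      ∑ n ∈ range (N % Q), ∑ h ∈ range (N % Q), G (n - h) := by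
  have hcol : ∀ n : ℤ, ∑ h ∈ range N, G (n - h) = ∑ h ∈ range (N % Q), G (n - h) := by
    intro n
    refine sum_range_of_periodic (fun x => ?_) ?_ N
    · rw [← hper (n - ((x + Q : ℕ) : ℤ))]
      congr 1
      push_cast
      ring
    · rw [← Finset.sum_range_reflect, ← h0 (n - Q + 1)]
      refine Finset.sum_congr rfl fun x hx => ?_
      have := Finset.mem_range.1 hx
      congr 1
      omega
  have hrow : ∀ h : ℤ, ∑ n ∈ range N, G (n - h) = ∑ n ∈ range (N % Q), G (n - h) := by
    intro h
    refine sum_range_of_periodic (fun x => ?_) ?_ N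
    · rw [← hper (x - h)]
      congr 1
      push_cast
      ring
    · rw [← h0 (-h)]
      exact Finset.sum_congr rfl fun x _ => by congr 1; ring
  simp only [hcol]
  rw [Finset.sum_comm]
  simp only [hrow]
  rw [Finset.sum_comm]

lemma sum_range_dvd_indicator {R : ℕ} (hR : 0 < R) (z : ℤ) :
    ∑ x ∈ range R, (if (R : ℤ) ∣ z + x then (1 : ℝ) else 0) = 1 := by
  have hRz : (0 : ℤ) < R := by exact_mod_cast hR
  have h0 := Int.emod_nonneg (-z) hRz.ne'
  have h1 := Int.emod_lt_of_pos (-z) hRz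
  rw [Finset.sum_eq_single ((-z) % R).toNat]
  · rw [if_pos]
    rw [Int.toNat_of_nonneg h0, Int.emod_def]
    exact ⟨-(-z / R), by ring⟩
  · intro x hx hne
    have hx := Finset.mem_range.1 hx
    rw [if_neg]
    intro hd
    apply hne
    have h2 : (x : ℤ) % R = (-z) % R := by
      rw [Int.emod_eq_emod_iff_emod_sub_eq_zero]
      refine Int.emod_eq_zero_of_dvd ?_
      convert hd using 1
      ring
    rw [Int.emod_eq_of_lt (by omega) (by omega)] at h2
    omega
  · intro h
    exact absurd (Finset.mem_range.2 (by omega)) h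

lemma abs_sum_sum_sub_le_of_support {Q R P r : ℕ} (hR : 0 < R) (hQ : Q = R * P) (hr : r ≤ Q)
    {G : ℤ → ℝ} {b : ℝ} (hb : 0 ≤ b) (hG : ∀ d, |G d| ≤ if (R : ℤ) ∣ d then b else 0) :
    |∑ n ∈ range r, ∑ h ∈ range r, G (n - h)| ≤ Q * (P * b) := by
  have hcol : ∀ h : ℕ, |∑ n ∈ range r, G (n - h)| ≤ P * b := by
    intro h
    calc |∑ n ∈ range r, G (n - h)| ≤ ∑ n ∈ range r, |G (n - h)| := Finset.abs_sum_le_sum_abs _ _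
      _ ≤ ∑ n ∈ range Q, |G (n - h)| :=
          Finset.sum_le_sum_of_subset_of_nonneg (Finset.range_subset_range.2 hr)
            fun _ _ _ => abs_nonneg _
      _ ≤ ∑ n ∈ range (R * P), if (R : ℤ) ∣ (n : ℤ) - h then b else 0 := by
          rw [hQ]
          exact Finset.sum_le_sum fun _ _ => hG _
      _ = P * b := by
          rw [sum_range_mul_digits R P (fun n => if (R : ℤ) ∣ (n : ℤ) - h then b else 0),
            Finset.sum_comm]
          have : ∀ t ∈ range P, ∑ i ∈ range R,
              (if (R : ℤ) ∣ ((i + R * t : ℕ) : ℤ) - h then b else 0) = b := by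
            intro t _
            conv_rhs => rw [← mul_one b, ← sum_range_dvd_indicator hR (R * t - h), Finset.mul_sum]
            refine Finset.sum_congr rfl fun i _ => ?_
            rw [mul_ite, mul_one, mul_zero]
            congr 2
            push_cast
            ring
          rw [Finset.sum_congr rfl this]
          simp
  rw [Finset.sum_comm]
  calc |∑ h ∈ range r, ∑ n ∈ range r, G (n - h)|
      ≤ ∑ h ∈ range r, |∑ n ∈ range r, G (n - h)| := Finset.abs_sum_le_sum_abs _ _
    _ ≤ ∑ h ∈ range r, P * b := Finset.sum_le_sum fun h _ => hcol h
    _ = r * (P * b) := by simp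
    _ ≤ Q * (P * b) := by gcongr

/-- The summands of the expansion of `1 + γ K`, where `K` is the shift-averaged kernel:
the constant `C` and the level kernels weighted by `γ`. -/
noncomputable def kernelTerm (C γ : ℝ) (p m : ℕ) : ℕ → ℤ → ℝ
  | 0, _ => C
  | a + 1, d => γ * levelKernel p m a d

/-- The contribution of a level `a` in the bound for the double sum over the kernel. -/
noncomputable def termBound (N : ℕ) (C γ : ℝ) (p a : ℕ) : ℝ :=
  if a = 0 then C else γ * ((if p ≤ N then (p : ℝ) ^ 2 else (N : ℝ) ^ 2) / 4)

lemma kernelTerm_add_mul {p : ℕ} (hp : 0 < p) (C γ : ℝ) (m a : ℕ) {d k : ℤ}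
    (hk : (p : ℤ) ^ a ∣ k) : kernelTerm C γ p m a (d + k) = kernelTerm C γ p m a d := by
  cases a with
  | zero => rfl
  | succ a =>
    obtain ⟨e, rfl⟩ := hk
    rw [kernelTerm, kernelTerm, levelKernel_add_mul hp]

lemma abs_kernelTerm_le {p : ℕ} (hp : 0 < p) {C γ : ℝ} (hC : 0 ≤ C) (hγ : 0 ≤ γ) (m a : ℕ)
    (d : ℤ) : |kernelTerm C γ p m a d| ≤ if (p : ℤ) ^ (a - 1) ∣ d then
      (if a = 0 then C else γ * (1 / 4 / (p : ℝ) ^ (a - 1))) else 0 := by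
  cases a with
  | zero => simp [kernelTerm, abs_of_nonneg hC]
  | succ a =>
    have h := mul_le_mul_of_nonneg_left (abs_levelKernel_le hp m a d) hγ
    rw [kernelTerm, abs_mul, abs_of_nonneg hγ]
    simpa [mul_ite] using h

section Product

variable {ι : Type*} [Fintype ι]

lemma sum_window_prod_kernelTerm [DecidableEq ι] {p : ι → ℕ}
    (hp : ∀ j, (p j).Prime) (hinj : Function.Injective p) (C γ : ι → ℝ)
    (m α : ι → ℕ) {j₀ : ι} (hj₀ : α j₀ ≠ 0) (z : ℤ) :
    ∑ x ∈ range (∏ j, p j ^ α j), ∏ j, kernelTerm (C j) (γ j) (p j) (m j) (α j) (z + x) = 0 := by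
  obtain ⟨a, ha⟩ := Nat.exists_eq_succ_of_ne_zero hj₀
  obtain ⟨u, hu⟩ : ∃ u, u = ∏ j ∈ univ.erase j₀, p j ^ α j := ⟨_, rfl⟩
  have hQ : ∏ j, p j ^ α j = p j₀ ^ a * u * p j₀ := by
    rw [← Finset.mul_prod_erase _ _ (Finset.mem_univ j₀), ← hu, ha, pow_succ]
    ring
  have hcop : IsCoprime (p j₀ : ℤ) (u : ℤ) := by
    rw [hu]
    push_cast
    refine IsCoprime.prod_right fun j hj => IsCoprime.pow_right ?_
    rw [Nat.isCoprime_iff_coprime, Nat.coprime_primes (hp _) (hp _)]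
    exact fun h => (Finset.ne_of_mem_erase hj) (hinj h).symm
  rw [hQ, sum_range_mul_digits _ _
    (fun x : ℕ => ∏ j, kernelTerm (C j) (γ j) (p j) (m j) (α j) (z + x))]
  refine Finset.sum_eq_zero fun y _ => ?_
  have hfac : ∀ i : ℕ, ∏ j, kernelTerm (C j) (γ j) (p j) (m j) (α j)
      (z + ((y + p j₀ ^ a * u * i : ℕ) : ℤ)) =
      γ j₀ * levelKernel (p j₀) (m j₀) a ((z + y) + i * ((p j₀ : ℤ) ^ a * u)) *
        ∏ j ∈ univ.erase j₀, kernelTerm (C j) (γ j) (p j) (m j) (α j) (z + y) := by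
    intro i
    have hz : z + ((y + p j₀ ^ a * u * i : ℕ) : ℤ) = (z + y) + i * ((p j₀ : ℤ) ^ a * u) := by
      push_cast
      ring
    rw [hz, ← Finset.mul_prod_erase _ _ (Finset.mem_univ j₀), ha, kernelTerm]
    congr 1
    refine Finset.prod_congr rfl fun j hj => kernelTerm_add_mul (hp j).pos _ _ _ _ ?_
    have : p j ^ α j ∣ u := hu ▸ Finset.dvd_prod_of_mem (fun j => p j ^ α j) hj
    exact Dvd.dvd.mul_left (Dvd.dvd.mul_left (by exact_mod_cast this) _) _
  simp only [hfac]
  rw [← Finset.sum_mul, ← Finset.mul_sum, sum_levelKernel_add_mul (hp j₀).pos _ _ _ hcop]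
  simp

lemma abs_prod_kernelTerm_le {p : ι → ℕ} (hp : ∀ j, (p j).Prime)
    (hinj : Function.Injective p) {C γ : ι → ℝ} (hC : ∀ j, 0 ≤ C j) (hγ : ∀ j, 0 ≤ γ j)
    (m α : ι → ℕ) (d : ℤ) :
    |∏ j, kernelTerm (C j) (γ j) (p j) (m j) (α j) d| ≤
      if ((∏ j, p j ^ (α j - 1) : ℕ) : ℤ) ∣ d then
        ∏ j, (if α j = 0 then C j else γ j * (1 / 4 / (p j : ℝ) ^ (α j - 1))) else 0 := by
  rw [Finset.abs_prod]
  refine (Finset.prod_le_prod (fun _ _ => abs_nonneg _)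
    fun j _ => abs_kernelTerm_le (hp j).pos (hC j) (hγ j) (m j) (α j) d).trans ?_
  by_cases hd : ∀ j, (p j : ℤ) ^ (α j - 1) ∣ d
  · rw [if_pos]
    · simp [hd]
    · push_cast
      refine Finset.prod_dvd_of_coprime (fun i _ j _ hij => ?_) fun j _ => hd j
      refine IsCoprime.pow ?_
      rw [Nat.isCoprime_iff_coprime, Nat.coprime_primes (hp _) (hp _)]
      exact fun h => hij (hinj h)
  · push Not at hd
    obtain ⟨j, hj⟩ := hd
    rw [Finset.prod_eq_zero (Finset.mem_univ j) (if_neg hj)]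
    split_ifs
    · refine Finset.prod_nonneg fun i _ => ?_
      split_ifs
      · exact hC i
      · exact mul_nonneg (hγ i) (by positivity)
    · exact le_rfl

lemma termBound_nonneg {C γ : ℝ} (hC : 0 ≤ C) (hγ : 0 ≤ γ) (N p a : ℕ) :
    0 ≤ termBound N C γ p a := by
  rw [termBound]
  split_ifs <;> positivity

lemma abs_sum_sum_prod_kernelTerm_le [DecidableEq ι] {p : ι → ℕ} (hp : ∀ j, (p j).Prime)
    (hinj : Function.Injective p) {C γ : ι → ℝ} (hC : ∀ j, 0 ≤ C j) (hγ : ∀ j, 0 ≤ γ j)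
    (m : ι → ℕ) {α : ι → ℕ} (hα : α ≠ 0) {N : ℕ} (hN : 0 < N) :
    |∑ n ∈ range N, ∑ h ∈ range N,
        ∏ j, kernelTerm (C j) (γ j) (p j) (m j) (α j) ((n : ℤ) - h)| ≤
      ∏ j, termBound N (C j) (γ j) (p j) (α j) := by
  have hN1 : (1 : ℝ) ≤ N := by exact_mod_cast hN
  have hp1 : ∀ j, (1 : ℝ) ≤ p j := fun j => by exact_mod_cast (hp j).one_lt.le
  have hpp : ∀ j, (0 : ℝ) < p j := fun j => by exact_mod_cast (hp j).pos
  by_cases hlarge : ∃ j, α j ≠ 0 ∧ N < p j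
  · obtain ⟨j₁, hj₁, hNp⟩ := hlarge
    obtain ⟨β, hβ⟩ : ∃ β : ι → ℝ, β = fun j => if α j = 0 then C j else γ j * (1 / 4) := ⟨_, rfl⟩
    have hβ0 : ∀ j, 0 ≤ β j := by
      intro j
      rw [hβ]
      have := hC j
      have := hγ j
      dsimp only
      split_ifs <;> positivity
    have hterm : ∀ d, |∏ j, kernelTerm (C j) (γ j) (p j) (m j) (α j) d| ≤ ∏ j, β j := by
      intro d
      rw [Finset.abs_prod]
      refine Finset.prod_le_prod (fun _ _ => abs_nonneg _) fun j _ =>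
        (abs_kernelTerm_le (hp j).pos (hC j) (hγ j) (m j) (α j) d).trans ?_
      split_ifs with h1 h2
      · simp [hβ, h2]
      · have h3 : 1 / 4 / (p j : ℝ) ^ (α j - 1) ≤ 1 / 4 :=
          div_le_self (by norm_num) (one_le_pow₀ (hp1 j))
        simpa [hβ, h2] using mul_le_mul_of_nonneg_left h3 (hγ j)
      · exact hβ0 j
    have hle : ∀ j, β j ≤ termBound N (C j) (γ j) (p j) (α j) := by
      intro j
      rw [hβ, termBound]
      dsimp only
      split_ifs
      · exact le_rfl
      · exact mul_le_mul_of_nonneg_left (by linarith [one_le_pow₀ (n := 2) (hp1 j)]) (hγ j)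
      · exact mul_le_mul_of_nonneg_left (by linarith [one_le_pow₀ (n := 2) hN1]) (hγ j)
    calc _ ≤ ∑ n ∈ range N, ∑ h ∈ range N,
          |∏ j, kernelTerm (C j) (γ j) (p j) (m j) (α j) ((n : ℤ) - h)| :=
          (Finset.abs_sum_le_sum_abs _ _).trans
            (Finset.sum_le_sum fun _ _ => Finset.abs_sum_le_sum_abs _ _)
      _ ≤ ∑ n ∈ range N, ∑ h ∈ range N, ∏ j, β j :=
          Finset.sum_le_sum fun _ _ => Finset.sum_le_sum fun _ _ => hterm _
      _ = ((N : ℝ) ^ 2 * β j₁) * ∏ j ∈ univ.erase j₁, β j := by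
          rw [← Finset.mul_prod_erase _ _ (Finset.mem_univ j₁)]
          simp only [sum_const, card_range, nsmul_eq_mul]
          ring
      _ ≤ termBound N (C j₁) (γ j₁) (p j₁) (α j₁) *
            ∏ j ∈ univ.erase j₁, termBound N (C j) (γ j) (p j) (α j) := by
          refine mul_le_mul (le_of_eq ?_)
            (Finset.prod_le_prod (fun j _ => hβ0 j) fun j _ => hle j)
            (Finset.prod_nonneg fun j _ => hβ0 j) (termBound_nonneg (hC _) (hγ _) _ _ _)
          rw [hβ, termBound]
          simp only [hj₁, if_false, not_le.2 hNp]
          ring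
      _ = _ := Finset.mul_prod_erase _ (fun j => termBound N (C j) (γ j) (p j) (α j))
          (Finset.mem_univ j₁)
  · push Not at hlarge
    obtain ⟨j₀, hj₀⟩ := Function.ne_iff.1 hα
    have hQ : ∏ j, p j ^ α j =
        (∏ j, p j ^ (α j - 1)) * ∏ j, (if α j = 0 then 1 else p j) := by
      rw [← Finset.prod_mul_distrib]
      refine Finset.prod_congr rfl fun j _ => ?_
      split_ifs with h
      · simp [h]
      · rw [← pow_succ, Nat.sub_add_cancel (Nat.pos_of_ne_zero h)]
    have hQpos : 0 < ∏ j, p j ^ α j := Finset.prod_pos fun j _ => pow_pos (hp j).pos _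
    rw [sum_sum_sub_of_periodic (Q := ∏ j, p j ^ α j)
      (G := fun d => ∏ j, kernelTerm (C j) (γ j) (p j) (m j) (α j) d) ?_
      (fun z => sum_window_prod_kernelTerm hp hinj C γ m α hj₀ z) N]
    · refine (abs_sum_sum_sub_le_of_support
        (Finset.prod_pos fun j _ => pow_pos (hp j).pos _) hQ (Nat.mod_lt _ hQpos).le
        (Finset.prod_nonneg fun i _ => ?_)
        fun d => abs_prod_kernelTerm_le hp hinj hC hγ m α d).trans (le_of_eq ?_)
      · have := hC i
        have := hγ i
        split_ifs <;> positivity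
      · rw [hQ]
        push_cast
        rw [← Finset.prod_mul_distrib, ← Finset.prod_mul_distrib, ← Finset.prod_mul_distrib]
        refine Finset.prod_congr rfl fun j _ => ?_
        have := hpp j
        rw [termBound]
        split_ifs with h h'
        · simp [h]
        · field_simp
        · exact absurd (hlarge j h) h'
    · intro d
      refine Finset.prod_congr rfl fun j _ => kernelTerm_add_mul (hp j).pos _ _ _ _ ?_
      have : p j ^ α j ∣ ∏ j, p j ^ α j :=
        Finset.dvd_prod_of_mem (fun j => p j ^ α j) (Finset.mem_univ j)
      exact_mod_cast this

lemma sum_sum_prod_sum_kernelTerm_le [DecidableEq ι] {p : ι → ℕ} (hp : ∀ j, (p j).Prime)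
    (hinj : Function.Injective p) {C γ : ι → ℝ} (hC : ∀ j, 0 ≤ C j) (hγ : ∀ j, 0 ≤ γ j)
    (m : ι → ℕ) {N : ℕ} (hN : 0 < N) :
    ∑ n ∈ range N, ∑ h ∈ range N,
        ∏ j, ∑ a ∈ range (m j + 1), kernelTerm (C j) (γ j) (p j) (m j) a ((n : ℤ) - h) ≤
      (N : ℝ) ^ 2 * ∏ j, C j +
        ∏ j, ∑ a ∈ range (m j + 1), termBound N (C j) (γ j) (p j) a := by
  simp only [Finset.prod_univ_sum]
  rw [Finset.sum_congr rfl fun n _ => Finset.sum_comm, Finset.sum_comm]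
  have h0 : (0 : ι → ℕ) ∈ Fintype.piFinset fun j => range (m j + 1) := by simp
  rw [← Finset.add_sum_erase _ _ h0]
  refine add_le_add (le_of_eq ?_) ?_
  · simp only [kernelTerm, sum_const, card_range, nsmul_eq_mul]
    ring
  · refine (Finset.sum_le_sum fun α hα => (le_abs_self _).trans
      (abs_sum_sum_prod_kernelTerm_le hp hinj hC hγ m (Finset.ne_of_mem_erase hα) hN)).trans ?_
    exact Finset.sum_le_sum_of_subset_of_nonneg (Finset.erase_subset _ _)
      fun α _ _ => Finset.prod_nonneg fun j _ => termBound_nonneg (hC j) (hγ j) _ _ _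

end Product

lemma sum_range_cast (n : ℕ) : ∑ a ∈ range n, (a : ℝ) = n * (n - 1) / 2 := by
  induction n with
  | zero => simp
  | succ n ih => rw [Finset.sum_range_succ, ih]; push_cast; ring

lemma sum_range_midpoint_sq (n : ℕ) :
    ∑ a ∈ range n, ((a : ℝ) + 1 / 2) ^ 2 = (n : ℝ) ^ 3 / 3 - n / 12 := by
  induction n with
  | zero => simp
  | succ n ih => rw [Finset.sum_range_succ, ih]; push_cast; ring

lemma sum_midShift {p : ℕ} (hp : 0 < p) (m n : ℕ) :
    ∑ t ∈ range (p ^ m), (truncRadInv p m (n + t) + 1 / (2 * (p : ℝ) ^ m)) =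
      (p : ℝ) ^ m / 2 := by
  have hp' : (0 : ℝ) < p := by exact_mod_cast hp
  rw [sum_truncRadInv hp m (fun x => x + 1 / (2 * (p : ℝ) ^ m)), Finset.sum_add_distrib,
    ← Finset.sum_div, sum_range_cast]
  simp only [sum_const, card_range, nsmul_eq_mul]
  push_cast
  field_simp
  ring

lemma sum_midShift_sq_le {p : ℕ} (hp : 0 < p) (m n : ℕ) :
    ∑ t ∈ range (p ^ m), (truncRadInv p m (n + t) + 1 / (2 * (p : ℝ) ^ m)) ^ 2 ≤
      (p : ℝ) ^ m / 3 := by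
  have hp' : (0 : ℝ) < p := by exact_mod_cast hp
  rw [sum_truncRadInv hp m (fun x => (x + 1 / (2 * (p : ℝ) ^ m)) ^ 2)]
  have h : ∀ a ∈ range (p ^ m), ((a : ℝ) / (p : ℝ) ^ m + 1 / (2 * (p : ℝ) ^ m)) ^ 2 =
      ((a : ℝ) + 1 / 2) ^ 2 / ((p : ℝ) ^ m) ^ 2 := by
    intro a _
    field_simp
  rw [Finset.sum_congr rfl h, ← Finset.sum_div, sum_range_midpoint_sq, div_le_iff₀ (by positivity)]
  push_cast
  have : (0 : ℝ) ≤ (p : ℝ) ^ m := by positivity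
  nlinarith

lemma sum_one_add_min_midShift {p : ℕ} (hp : 0 < p) (γ : ℝ) (m n h : ℕ) :
    ∑ t ∈ range (p ^ m), (1 + γ * min (1 - (truncRadInv p m (n + t) + 1 / (2 * (p : ℝ) ^ m)))
        (1 - (truncRadInv p m (h + t) + 1 / (2 * (p : ℝ) ^ m)))) =
      (p : ℝ) ^ m * ∑ a ∈ range (m + 1),
        kernelTerm (1 + γ * (1 / 2 - gridMean p m)) γ p m a ((n : ℤ) - h) := by
  have hmin : ∀ x y e : ℝ, 1 + γ * min (1 - (x + e)) (1 - (y + e)) =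
      1 + γ - γ / 2 * (x + e) - γ / 2 * (y + e) - γ / 2 * |x - y| := by
    intro x y e
    rcases le_total x y with hxy | hxy
    · rw [min_eq_right (by linarith), abs_of_nonpos (by linarith)]
      ring
    · rw [min_eq_left (by linarith), abs_of_nonneg (by linarith)]
      ring
  simp only [hmin]
  rw [Finset.sum_sub_distrib, Finset.sum_sub_distrib, Finset.sum_sub_distrib, ← Finset.mul_sum,
    ← Finset.mul_sum, ← Finset.mul_sum, sum_midShift hp, sum_midShift hp,
    sum_abs_truncRadInv_sub hp, Finset.sum_range_succ']
  simp only [kernelTerm, sum_const, card_range, nsmul_eq_mul, ← Finset.mul_sum]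
  push_cast
  ring

lemma le_sum_one_add_midShift_sq {p : ℕ} (hp : 0 < p) {γ : ℝ} (hγ : 0 ≤ γ) (m n : ℕ) :
    (p : ℝ) ^ m * (1 + γ / 3) ≤ ∑ t ∈ range (p ^ m),
      (1 + γ / 2 * (1 - (truncRadInv p m (n + t) + 1 / (2 * (p : ℝ) ^ m)) ^ 2)) := by
  have h := mul_le_mul_of_nonneg_left (sum_midShift_sq_le hp m n) hγ
  rw [Finset.sum_add_distrib, ← Finset.mul_sum, Finset.sum_sub_distrib]
  simp only [sum_const, card_range, nsmul_eq_mul]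
  push_cast
  linarith

lemma sum_sqErr_shift_le {s N : ℕ} (hN : 0 < N) {p : ℕ → ℕ} (hp : ∀ j < s, (p j).Prime)
    (hdist : ∀ i < s, ∀ j < s, p i = p j → i = j) (m : ℕ → ℕ) {γ : ℕ → ℝ}
    (hγ : ∀ j, 0 ≤ γ j) :
    ∑ τ ∈ Fintype.piFinset fun j : Fin s => range (p j ^ m j),
      sqErr s N γ (fun n j => truncRadInv (p j) (m j) (n + τ j) + 1 / (2 * (p j : ℝ) ^ m j)) ≤
    (∏ j : Fin s, (p j : ℝ) ^ m j) *
      (1 / (N : ℝ) ^ 2 *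
        ((N : ℝ) ^ 2 * ∏ j : Fin s, (1 + γ j * (1 / 2 - gridMean (p j) (m j))) +
          ∏ j : Fin s, ∑ a ∈ range (m j + 1),
            termBound N (1 + γ j * (1 / 2 - gridMean (p j) (m j))) (γ j) (p j) a) -
        ∏ j : Fin s, (1 + γ j / 3)) := by
  have hN' : (0 : ℝ) < N := by exact_mod_cast hN
  have hpos : ∀ j : Fin s, 0 < p j := fun j => (hp j j.2).pos
  have hinj : Function.Injective fun j : Fin s => p j :=
    fun i j h => Fin.ext (hdist i i.2 j j.2 h)
  have hC : ∀ j : Fin s, 0 ≤ 1 + γ j * (1 / 2 - gridMean (p j) (m j)) := fun j =>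
    add_nonneg zero_le_one (mul_nonneg (hγ j) (by linarith [gridMean_le (p j) (m j)]))
  have hkernel := sum_sum_prod_sum_kernelTerm_le (fun j : Fin s => hp j j.2) hinj hC
    (fun j => hγ j) (fun j => m j) hN
  rw [← Fin.sum_univ_eq_sum_range (fun n => ∑ h ∈ range N, ∏ j : Fin s,
    ∑ a ∈ range (m j + 1), kernelTerm (1 + γ j * (1 / 2 - gridMean (p j) (m j))) (γ j) (p j)
      (m j) a ((n : ℤ) - h))] at hkernel
  simp only [← Fin.sum_univ_eq_sum_range (fun h => ∏ j : Fin s,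
    ∑ a ∈ range (m j + 1), kernelTerm (1 + γ j * (1 / 2 - gridMean (p j) (m j))) (γ j) (p j)
      (m j) a (_ - (h : ℤ)))] at hkernel
  have hcard : ((Fintype.piFinset fun j : Fin s => range (p j ^ m j)).card : ℝ) =
      ∏ j : Fin s, (p j : ℝ) ^ m j := by
    simp
  have hsq : (N : ℝ) * ((∏ j : Fin s, (p j : ℝ) ^ m j) * ∏ j : Fin s, (1 + γ j / 3)) ≤
      ∑ τ ∈ Fintype.piFinset fun j : Fin s => range (p j ^ m j), ∑ n : Fin N, ∏ j : Fin s,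
        (1 + γ j / 2 *
          (1 - (truncRadInv (p j) (m j) (n + τ j) + 1 / (2 * (p j : ℝ) ^ m j)) ^ 2)) := by
    rw [Finset.sum_comm]
    calc _ = ∑ n : Fin N, ∏ j : Fin s, ((p j : ℝ) ^ m j * (1 + γ j / 3)) := by
          simp [Finset.prod_mul_distrib]
      _ ≤ _ := Finset.sum_le_sum fun n _ => ?_
    rw [← Finset.prod_univ_sum (fun j : Fin s => range (p j ^ m j))
      (fun j t => 1 + γ j / 2 *
        (1 - (truncRadInv (p j) (m j) (n + t) + 1 / (2 * (p j : ℝ) ^ m j)) ^ 2))]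
    exact Finset.prod_le_prod (fun j _ => mul_nonneg (by positivity) (by linarith [hγ j]))
      fun j _ => le_sum_one_add_midShift_sq (hpos j) (hγ j) _ _
  have hmin : ∑ τ ∈ Fintype.piFinset fun j : Fin s => range (p j ^ m j),
      ∑ n : Fin N, ∑ h : Fin N, ∏ j : Fin s,
        (1 + γ j * min (1 - (truncRadInv (p j) (m j) (n + τ j) + 1 / (2 * (p j : ℝ) ^ m j)))
          (1 - (truncRadInv (p j) (m j) (h + τ j) + 1 / (2 * (p j : ℝ) ^ m j)))) =
      (∏ j : Fin s, (p j : ℝ) ^ m j) * ∑ n : Fin N, ∑ h : Fin N, ∏ j : Fin s,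
        ∑ a ∈ range (m j + 1), kernelTerm (1 + γ j * (1 / 2 - gridMean (p j) (m j))) (γ j) (p j)
          (m j) a ((n : ℤ) - h) := by
    rw [Finset.sum_comm, Finset.mul_sum]
    refine Finset.sum_congr rfl fun n _ => ?_
    rw [Finset.sum_comm, Finset.mul_sum]
    refine Finset.sum_congr rfl fun h _ => ?_
    rw [← Finset.prod_univ_sum (fun j : Fin s => range (p j ^ m j))
      (fun j t => 1 + γ j *
        min (1 - (truncRadInv (p j) (m j) (n + t) + 1 / (2 * (p j : ℝ) ^ m j)))
          (1 - (truncRadInv (p j) (m j) (h + t) + 1 / (2 * (p j : ℝ) ^ m j)))),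
      ← Finset.prod_mul_distrib]
    exact Finset.prod_congr rfl fun j _ => sum_one_add_min_midShift (hpos j) _ _ _ _
  simp only [sqErr]
  rw [Finset.sum_add_distrib, Finset.sum_sub_distrib, ← Finset.mul_sum, ← Finset.mul_sum, hmin,
    sum_const, nsmul_eq_mul, hcard]
  have hW : 0 ≤ ∏ j : Fin s, (p j : ℝ) ^ m j := Finset.prod_nonneg fun j _ => by positivity
  have h1 := mul_le_mul_of_nonneg_left hsq (by positivity : (0 : ℝ) ≤ 2 / N)
  have h2 := mul_le_mul_of_nonneg_left (mul_le_mul_of_nonneg_left hkernel hW)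
    (by positivity : (0 : ℝ) ≤ 1 / (N : ℝ) ^ 2)
  have h3 : 2 / (N : ℝ) * (N * ((∏ j : Fin s, (p j : ℝ) ^ m j) * ∏ j : Fin s, (1 + γ j / 3))) =
      2 * ((∏ j : Fin s, (p j : ℝ) ^ m j) * ∏ j : Fin s, (1 + γ j / 3)) := by
    field_simp
  rw [h3] at h1
  linarith

lemma prod_add_mul_le {ι : Type*} (S : Finset ι) {a b : ι → ℝ} {t : ℝ} (ha : ∀ j, 0 ≤ a j)
    (hb : ∀ j, 0 ≤ b j) (ht0 : 0 ≤ t) (ht1 : t ≤ 1) :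
    ∏ j ∈ S, (a j + t * b j) ≤ (1 - t) * ∏ j ∈ S, a j + t * ∏ j ∈ S, (a j + b j) := by
  classical
  induction S using Finset.induction_on with
  | empty => simp
  | insert i S hi ih =>
    rw [Finset.prod_insert hi, Finset.prod_insert hi, Finset.prod_insert hi]
    have hle : ∏ j ∈ S, a j ≤ ∏ j ∈ S, (a j + b j) :=
      Finset.prod_le_prod (fun j _ => ha j) fun j _ => by linarith [hb j]
    have h1 := mul_le_mul_of_nonneg_left ih (add_nonneg (ha i) (mul_nonneg ht0 (hb i)))
    have h2 := mul_nonneg (mul_nonneg (mul_nonneg ht0 (sub_nonneg.2 ht1)) (hb i))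
      (sub_nonneg.2 hle)
    linarith

lemma sq_mul_log_le {N p : ℝ} (hN : 2 ≤ N) (hNp : N ≤ p) :
    N ^ 2 * Real.log p ≤ p ^ 2 * Real.log N := by
  have hN0 : 0 < N := by linarith
  have hlog : 1 / 2 ≤ Real.log N :=
    (by linarith [Real.log_two_gt_d9] : 1 / 2 ≤ Real.log 2).trans
      (Real.log_le_log (by norm_num) hN)
  have h1 := Real.log_le_sub_one_of_pos (div_pos (by linarith : 0 < p) hN0)
  rw [Real.log_div (by linarith) hN0.ne'] at h1
  have h2 := mul_le_mul_of_nonneg_left h1 (sq_nonneg N)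
  have h3 : N ^ 2 * (p / N - 1) = N * (p - N) := by field_simp
  have h4 : 0 ≤ (p - N) * ((p + N) * Real.log N - N) :=
    mul_nonneg (by linarith) (by nlinarith)
  nlinarith

lemma half_add_termBound_le {N p m : ℕ} (hN : 2 ≤ N) (hp : p.Prime)
    (hm : 0 < m ∧ N < p ^ m ∧ ∀ k, 0 < k → N < p ^ k → m ≤ k) :
    1 / 2 + m * ((if p ≤ N then (p : ℝ) ^ 2 else (N : ℝ) ^ 2) / 4) ≤
      2 * Real.log N * (p : ℝ) ^ 2 / Real.log p := by
  have hp2 : (2 : ℝ) ≤ p := by exact_mod_cast hp.two_le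
  have hN2 : (2 : ℝ) ≤ N := by exact_mod_cast hN
  have hlogp : 0 < Real.log p := Real.log_pos (by linarith)
  obtain ⟨hm0, -, hmin⟩ := hm
  rw [le_div_iff₀ hlogp]
  split_ifs with hpN
  · have hlog : Real.log p ≤ Real.log N :=
      Real.log_le_log (by linarith) (by exact_mod_cast hpN)
    have hpow : p ^ (m - 1) ≤ N := by
      rcases Nat.eq_zero_or_pos (m - 1) with h | h
      · rw [h, pow_zero]
        omega
      · by_contra! hlt
        have := hmin (m - 1) h hlt
        omega
    have hmlog : ((m : ℝ) - 1) * Real.log p ≤ Real.log N := by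
      have h := Real.log_le_log (by positivity) (by exact_mod_cast hpow : (p : ℝ) ^ (m - 1) ≤ N)
      rwa [Real.log_pow, Nat.cast_sub hm0, Nat.cast_one] at h
    have h1 : (m : ℝ) * Real.log p ≤ 2 * Real.log N := by linarith
    have h2 := mul_le_mul_of_nonneg_left h1 (sq_nonneg (p : ℝ))
    have h3 : Real.log p ≤ (p : ℝ) ^ 2 * Real.log N :=
      hlog.trans (le_mul_of_one_le_left (hlogp.le.trans hlog) (one_le_pow₀ (by linarith)))
    linarith
  · have hm1 : m = 1 := le_antisymm (hmin 1 one_pos (by simpa using hpN)) hm0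
    have h := sq_mul_log_le hN2 (by exact_mod_cast (not_le.1 hpN).le : (N : ℝ) ≤ p)
    have h1 : Real.log p ≤ (N : ℝ) ^ 2 * Real.log p :=
      le_mul_of_one_le_left hlogp.le (one_le_pow₀ (by linarith))
    rw [hm1]
    push_cast
    linarith

lemma sum_termBound_le {N p m : ℕ} (hN : 2 ≤ N) (hp : p.Prime)
    (hm : 0 < m ∧ N < p ^ m ∧ ∀ k, 0 < k → N < p ^ k → m ≤ k) {γ : ℝ} (hγ : 0 ≤ γ) :
    ∑ a ∈ range (m + 1), termBound N (1 + γ * (1 / 2 - gridMean p m)) γ p a ≤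
      1 + 2 * γ * Real.log N * (p : ℝ) ^ 2 / Real.log p := by
  have h := mul_le_mul_of_nonneg_left (half_add_termBound_le hN hp hm) hγ
  have hg := mul_nonneg hγ (gridMean_nonneg hp.pos m)
  have heq : γ * (2 * Real.log N * (p : ℝ) ^ 2 / Real.log p) =
      2 * γ * Real.log N * (p : ℝ) ^ 2 / Real.log p := by ring
  rw [heq] at h
  rw [Finset.sum_range_succ']
  simp only [termBound, Nat.succ_ne_zero, if_false, if_true, sum_const, card_range, nsmul_eq_mul]
  linarith

lemma sq_mul_prod_le {s N : ℕ} (hN : 0 < N) {p m : ℕ → ℕ} (hm : ∀ j < s, N < p j ^ m j)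
    {γ : ℕ → ℝ} (hγ : ∀ j, 0 ≤ γ j) :
    (N : ℝ) ^ 2 * ∏ j : Fin s, (1 + γ j * (1 / 2 - gridMean (p j) (m j))) ≤
      (N : ℝ) ^ 2 * ∏ j : Fin s, (1 + γ j / 3) + ∏ j : Fin s, (1 + γ j) := by
  have hN1 : (1 : ℝ) ≤ (N : ℝ) ^ 2 := one_le_pow₀ (by exact_mod_cast hN)
  have hN0 : (0 : ℝ) < (N : ℝ) ^ 2 := by linarith
  have hle : ∏ j : Fin s, (1 + γ j * (1 / 2 - gridMean (p j) (m j))) ≤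
      ∏ j : Fin s, ((1 + γ j / 3) + 1 / (N : ℝ) ^ 2 * (γ j / 6)) := by
    refine Finset.prod_le_prod (fun j _ => ?_) fun j _ => ?_
    · exact add_nonneg zero_le_one
        (mul_nonneg (hγ j) (by linarith [gridMean_le (p j) (m j)]))
    · have h1 : (N : ℝ) ^ 2 ≤ (p j : ℝ) ^ (2 * m j) := by
        rw [mul_comm, pow_mul]
        gcongr
        exact_mod_cast (hm j j.2).le
      have h2 := mul_le_mul_of_nonneg_left (one_div_le_one_div_of_le hN0 h1) (hγ j)
      rw [gridMean]
      linarith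
  have hconv := prod_add_mul_le (univ : Finset (Fin s)) (a := fun j => 1 + γ j / 3)
    (b := fun j => γ j / 6) (t := 1 / (N : ℝ) ^ 2) (fun j => by linarith [hγ j])
    (fun j => by linarith [hγ j]) (by positivity) (by rw [div_le_one hN0]; exact hN1)
  have hA : 0 ≤ ∏ j : Fin s, (1 + γ j / 3) :=
    Finset.prod_nonneg fun j _ => by linarith [hγ j]
  have hB : ∏ j : Fin s, ((1 + γ j / 3) + γ j / 6) ≤ ∏ j : Fin s, (1 + γ j) :=
    Finset.prod_le_prod (fun j _ => by linarith [hγ j]) fun j _ => by linarith [hγ j]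
  have h := mul_le_mul_of_nonneg_left (hle.trans hconv) hN0.le
  have heq : (N : ℝ) ^ 2 * ((1 - 1 / (N : ℝ) ^ 2) * ∏ j : Fin s, (1 + γ j / 3) +
      1 / (N : ℝ) ^ 2 * ∏ j : Fin s, ((1 + γ j / 3) + γ j / 6)) =
      (N : ℝ) ^ 2 * ∏ j : Fin s, (1 + γ j / 3) - ∏ j : Fin s, (1 + γ j / 3) +
        ∏ j : Fin s, ((1 + γ j / 3) + γ j / 6) := by
    rw [mul_add, ← mul_assoc, ← mul_assoc, mul_sub, mul_one_div_cancel hN0.ne']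
    ring
  rw [heq] at h
  linarith

/-- existence of a good mid-simplified shift in the finite set
`ℚ(p_1^{m_1}) × ⋯ × ℚ(p_s^{m_s})`. Indices are 0-based: the paper's `p_j, m_j, γ_j, σ_j` are
`p (j-1), m (j-1), γ (j-1), σ (j-1)`. -/
theorem exists_good_midsimplified_shift
    (s N : ℕ) (hN : 2 ≤ N)
    (p : ℕ → ℕ) (hp : ∀ j < s, (p j).Prime)
    (hdist : ∀ i < s, ∀ j < s, p i = p j → i = j)
    (m : ℕ → ℕ)
    (hm : ∀ j < s, 0 < m j ∧ N < p j ^ m j ∧ ∀ k, 0 < k → N < p j ^ k → m j ≤ k)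
    (γ : ℕ → ℝ) (hγpos : ∀ j, 0 < γ j) (hγ1 : γ 0 ≤ 1) (hγmon : Antitone γ) :
    ∃ σ : ℕ → ℝ, (∀ j < s, QSet (p j) (m j) (σ j)) ∧
      sqErr s N γ
          (fun n j => midShift (p j.val) (m j.val) (radInv (p j.val) n.val) (σ j.val)) ≤
        1 / (N : ℝ) ^ 2 *
          ((∏ j ∈ Finset.range s, (1 + 2 * γ j * Real.log N * (p j : ℝ) ^ 2 / Real.log (p j))) +
            (∏ j ∈ Finset.range s, (1 + γ j)) *
              ∏ j ∈ Finset.range s, (1 + γ j * (p j : ℝ) / 6)) := by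
  have hpos : ∀ j < s, 0 < p j := fun j hj => (hp j hj).pos
  have hN0 : 0 < N := by omega
  have hγ : ∀ j, 0 ≤ γ j := fun j => (hγpos j).le
  have hW : 0 ≤ ∏ j : Fin s, (p j : ℝ) ^ m j := Finset.prod_nonneg fun j _ => by positivity
  have hbound : 1 / (N : ℝ) ^ 2 *
        ((N : ℝ) ^ 2 * ∏ j : Fin s, (1 + γ j * (1 / 2 - gridMean (p j) (m j))) +
          ∏ j : Fin s, ∑ a ∈ range (m j + 1),
            termBound N (1 + γ j * (1 / 2 - gridMean (p j) (m j))) (γ j) (p j) a) -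
        ∏ j : Fin s, (1 + γ j / 3) ≤
      1 / (N : ℝ) ^ 2 *
        ((∏ j ∈ Finset.range s, (1 + 2 * γ j * Real.log N * (p j : ℝ) ^ 2 / Real.log (p j))) +
          (∏ j ∈ Finset.range s, (1 + γ j)) *
            ∏ j ∈ Finset.range s, (1 + γ j * (p j : ℝ) / 6)) := by
    have hNr : (0 : ℝ) < (N : ℝ) ^ 2 := by positivity
    rw [← Fin.prod_univ_eq_prod_range, ← Fin.prod_univ_eq_prod_range (fun j => 1 + γ j),
      ← Fin.prod_univ_eq_prod_range (fun j => 1 + γ j * (p j : ℝ) / 6)]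
    have h1 := sq_mul_prod_le hN0 (fun j hj => (hm j hj).2.1) hγ
    have h2 : ∏ j : Fin s, ∑ a ∈ range (m j + 1),
        termBound N (1 + γ j * (1 / 2 - gridMean (p j) (m j))) (γ j) (p j) a ≤
        ∏ j : Fin s, (1 + 2 * γ j * Real.log N * (p j : ℝ) ^ 2 / Real.log (p j)) :=
      Finset.prod_le_prod (fun j _ => Finset.sum_nonneg fun a _ => termBound_nonneg
        (add_nonneg zero_le_one (mul_nonneg (hγ j) (by linarith [gridMean_le (p j) (m j)])))
        (hγ j) _ _ _) fun j _ => sum_termBound_le hN (hp j j.2) (hm j j.2) (hγ j)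
    have h3 : ∏ j : Fin s, (1 + γ j) ≤
        (∏ j : Fin s, (1 + γ j)) * ∏ j : Fin s, (1 + γ j * (p j : ℝ) / 6) :=
      le_mul_of_one_le_right (Finset.prod_nonneg fun j _ => by linarith [hγ j])
        (Finset.one_le_prod fun j _ => by
          have : 0 ≤ γ j * (p j : ℝ) / 6 := by have := hγ j; positivity
          simpa using this)
    rw [one_div, sub_le_iff_le_add, inv_mul_le_iff₀ hNr, mul_add, mul_inv_cancel_left₀ hNr.ne']
    linarith
  have hsum := (sum_sqErr_shift_le hN0 hp hdist m hγ).trans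
    (mul_le_mul_of_nonneg_left hbound hW)
  have hne : (Fintype.piFinset fun j : Fin s => range (p j ^ m j)).Nonempty :=
    Fintype.piFinset_nonempty.2 fun j =>
      Finset.nonempty_range_iff.2 (pow_pos (hpos j j.2) _).ne'
  have hcard : ((Fintype.piFinset fun j : Fin s => range (p j ^ m j)).card : ℝ) =
      ∏ j : Fin s, (p j : ℝ) ^ m j := by
    simp
  rw [← hcard, ← nsmul_eq_mul, ← Finset.sum_const] at hsum
  obtain ⟨τ, -, hle⟩ := Finset.exists_le_of_sum_le hne hsum
  refine ⟨fun j => if h : j < s then truncRadInv (p j) (m j) (τ ⟨j, h⟩) else 0,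
    fun j hj => ?_, ?_⟩
  · simp only [dif_pos hj]
    exact qSet_truncRadInv (hpos j hj) _ _
  · refine (congrArg (sqErr s N γ) ?_).trans_le hle
    funext n j
    simp only [dif_pos j.2]
    rw [midShift, radInv_eq_truncRadInv (n.2.trans (hm j j.2).2.1),
      simpShift_truncRadInv (hpos j j.2)]
end

section
/- Let p be a prime, m ∈ ℕ, let h ∈ ℚ(p^m) (so h = Σ_{r=1}^m h^{(r)} p^{−r} with digits h^{(r)} ∈ {0,…,p−1}), let σ_m ∈ ℚ(p^m), and let δ ∈ [0, p^{−m}) (so that the base-p digits of δ in positions 1 through m all vanish). Write φ_p^+(h) + φ_p^+(σ_m) = Σ_{r=1}^{m+1} y_r p^{r−1} with digits y_r ∈ {0,…,p−1}, and set ξ(h, σ_m) := φ_p(y_{m+1} p^m) = y_{m+1} p^{−(m+1)}. Then h ⊕_p (σ_m + δ) = (h ⊕_{p,m}^{simp} σ_m) + (ξ(h, σ_m) ⊕_p δ), and in particular ξ(h, σ_m) ∈ [0, p^{−m}) and ξ(h, σ_m) ⊕_p δ ∈ [0, p^{−m}). -/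
open MeasureTheory Finset

lemma rdigit_eq_natFloor (p : ℕ) (x : ℝ) (r : ℕ) :
    rdigit p x r = ⌊x * (p : ℝ) ^ (r + 1)⌋₊ % p := by
  rw [rdigit, Int.floor_toNat]

lemma rdigit_zero (p r : ℕ) : rdigit p 0 r = 0 := by
  simp [rdigit]

lemma rdigit_lt {p : ℕ} (hp : 0 < p) (x : ℝ) (r : ℕ) : rdigit p x r < p :=
  Nat.mod_lt _ hp

/-- The digits of `b / p^m + δ` at positions below `m` are those of `b / p^m`. -/
lemma rdigit_add_of_lt {p : ℕ} (hp : 0 < p) {m r k : ℕ} (hm : m = r + 1 + k) (b : ℕ) {δ : ℝ}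
    (hδ₀ : 0 ≤ δ) (hδ : δ < ((p : ℝ) ^ m)⁻¹) :
    rdigit p ((b : ℝ) / (p : ℝ) ^ m + δ) r = b / p ^ k % p := by
  have hpR : (0 : ℝ) < p := by exact_mod_cast hp
  have hδ' : δ * (p : ℝ) ^ m < 1 := by
    rwa [← lt_div_iff₀ (by positivity), one_div]
  have hfloor : ⌊(b : ℝ) + δ * (p : ℝ) ^ m⌋₊ = b := by
    rw [Nat.floor_eq_iff (by positivity)]
    constructor
    · have : 0 ≤ δ * (p : ℝ) ^ m := by positivity
      linarith
    · linarith
  have hscale : ((b : ℝ) / (p : ℝ) ^ m + δ) * (p : ℝ) ^ (r + 1)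
      = ((b : ℝ) + δ * (p : ℝ) ^ m) / ((p ^ k : ℕ) : ℝ) := by
    subst hm
    push_cast
    rw [pow_add _ (r + 1) k]
    field_simp
  rw [rdigit_eq_natFloor, hscale, Nat.floor_div_natCast, hfloor]

/-- The digits of `b / p^m + δ` at positions from `m` on are those of `δ`. -/
lemma rdigit_add_of_le {p : ℕ} (hp : 0 < p) {m r : ℕ} (hr : m ≤ r) (b : ℕ) {δ : ℝ}
    (hδ₀ : 0 ≤ δ) :
    rdigit p ((b : ℝ) / (p : ℝ) ^ m + δ) r = rdigit p δ r := by
  have hpR : (0 : ℝ) < p := by exact_mod_cast hp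
  obtain ⟨k, rfl⟩ := Nat.exists_eq_add_of_le hr
  have hscale : ((b : ℝ) / (p : ℝ) ^ m + δ) * (p : ℝ) ^ (m + k + 1)
      = δ * (p : ℝ) ^ (m + k + 1) + ((p * (b * p ^ k) : ℕ) : ℝ) := by
    push_cast
    rw [add_mul, add_comm, pow_succ, pow_add]
    field_simp
  rw [rdigit_eq_natFloor, rdigit_eq_natFloor, hscale, Nat.floor_add_natCast (by positivity),
    Nat.add_mul_mod_self_left]

lemma rdigit_div_pow_of_lt {p : ℕ} (hp : 0 < p) {m r k : ℕ} (hm : m = r + 1 + k) (b : ℕ) :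
    rdigit p ((b : ℝ) / (p : ℝ) ^ m) r = b / p ^ k % p := by
  have hpR : (0 : ℝ) < p := by exact_mod_cast hp
  simpa using rdigit_add_of_lt hp hm b le_rfl (δ := 0) (by positivity)

lemma rdigit_div_pow_of_le {p : ℕ} (hp : 0 < p) {m r : ℕ} (hr : m ≤ r) (b : ℕ) :
    rdigit p ((b : ℝ) / (p : ℝ) ^ m) r = 0 := by
  simpa [rdigit_zero] using rdigit_add_of_le hp hr b (le_refl (0 : ℝ))

lemma rdigit_of_lt_inv_pow {p : ℕ} (hp : 0 < p) {m r : ℕ} (hr : r < m) {δ : ℝ}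
    (hδ₀ : 0 ≤ δ) (hδ : δ < ((p : ℝ) ^ m)⁻¹) : rdigit p δ r = 0 := by
  obtain ⟨k, hk⟩ := Nat.exists_eq_add_of_le (Nat.succ_le_of_lt hr)
  simpa using rdigit_add_of_lt hp hk 0 hδ₀ hδ

lemma rdigit_div_pow_add {p : ℕ} (hp : 0 < p) (m b : ℕ) {δ : ℝ}
    (hδ₀ : 0 ≤ δ) (hδ : δ < ((p : ℝ) ^ m)⁻¹) (r : ℕ) :
    rdigit p ((b : ℝ) / (p : ℝ) ^ m + δ) r
      = rdigit p ((b : ℝ) / (p : ℝ) ^ m) r + rdigit p δ r := by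
  rcases lt_or_ge r m with hr | hr
  · obtain ⟨k, hk⟩ := Nat.exists_eq_add_of_le (Nat.succ_le_of_lt hr)
    rw [rdigit_of_lt_inv_pow hp hr hδ₀ hδ, rdigit_add_of_lt hp hk b hδ₀ hδ,
      rdigit_div_pow_of_lt hp hk b, add_zero]
  · rw [rdigit_add_of_le hp hr b hδ₀, rdigit_div_pow_of_le hp hr b, zero_add]

/-- The base-`p` expansion read off by `rdigit` does not end in an infinite run of `p - 1`. -/
lemma exists_rdigit_ne_pred {p : ℕ} (hp : 1 < p) {x : ℝ} (hx : 0 ≤ x) (N : ℕ) :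
    ∃ r, N ≤ r ∧ rdigit p x r ≠ p - 1 := by
  by_contra! hall
  have hpR : (1 : ℝ) < p := by exact_mod_cast hp
  have hstep : ∀ r, N ≤ r →
      ⌊x * (p : ℝ) ^ (r + 1)⌋₊ + 1 = p * (⌊x * (p : ℝ) ^ r⌋₊ + 1) := by
    intro r hr
    have hdiv : ⌊x * (p : ℝ) ^ (r + 1)⌋₊ / p = ⌊x * (p : ℝ) ^ r⌋₊ := by
      rw [← Nat.floor_div_natCast, pow_succ]
      congr 1
      field_simp
    have hmod := hall r hr
    rw [rdigit_eq_natFloor] at hmod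
    have hsum := Nat.div_add_mod ⌊x * (p : ℝ) ^ (r + 1)⌋₊ p
    rw [hdiv, hmod] at hsum
    rw [mul_add]
    omega
  have hiter : ∀ k, ⌊x * (p : ℝ) ^ (N + k)⌋₊ + 1 = p ^ k * (⌊x * (p : ℝ) ^ N⌋₊ + 1) := by
    intro k
    induction k with
    | zero => simp
    | succ k ih => rw [← add_assoc, hstep _ (by omega), ih, pow_succ]; ring
  have hgap : 0 < (⌊x * (p : ℝ) ^ N⌋₊ : ℝ) + 1 - x * (p : ℝ) ^ N := by
    linarith [Nat.lt_floor_add_one (x * (p : ℝ) ^ N)]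
  obtain ⟨k, hk⟩ := pow_unbounded_of_one_lt
    (1 / ((⌊x * (p : ℝ) ^ N⌋₊ : ℝ) + 1 - x * (p : ℝ) ^ N)) hpR
  rw [div_lt_iff₀ hgap] at hk
  have hle : (⌊x * (p : ℝ) ^ (N + k)⌋₊ : ℝ) ≤ x * (p : ℝ) ^ (N + k) :=
    Nat.floor_le (by positivity)
  have hcast : (⌊x * (p : ℝ) ^ (N + k)⌋₊ : ℝ) + 1
      = (p : ℝ) ^ k * ((⌊x * (p : ℝ) ^ N⌋₊ : ℝ) + 1) := by exact_mod_cast hiter k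
  rw [pow_add] at hle hcast
  nlinarith

lemma truncVal_succ (p : ℕ) (x : ℝ) (n : ℕ) :
    truncVal p x (n + 1) = truncVal p x n + rdigit p x n * p ^ n :=
  Finset.sum_range_succ _ _

lemma truncVal_lt {p : ℕ} (hp : 0 < p) (x : ℝ) (n : ℕ) : truncVal p x n < p ^ n := by
  induction n with
  | zero => simp [truncVal]
  | succ n ih =>
    rw [truncVal_succ, pow_succ]
    have := rdigit_lt hp x n
    nlinarith [Nat.mul_le_mul_right (p ^ n) (Nat.succ_le_of_lt this)]

lemma truncVal_eq_of_le {p : ℕ} {x : ℝ} {m n : ℕ} (hx : ∀ r, m ≤ r → rdigit p x r = 0)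
    (hn : m ≤ n) : truncVal p x n = truncVal p x m := by
  induction n, hn using Nat.le_induction with
  | base => rfl
  | succ n hn ih => rw [truncVal_succ, hx n hn, ih, zero_mul, add_zero]

lemma truncVal_eq_zero {p : ℕ} {x : ℝ} {n : ℕ} (hx : ∀ r, r < n → rdigit p x r = 0) :
    truncVal p x n = 0 :=
  Finset.sum_eq_zero fun r hr => by rw [hx r (Finset.mem_range.mp hr), zero_mul]

lemma pow_dvd_truncVal {p : ℕ} {x : ℝ} {m : ℕ} (hx : ∀ r, r < m → rdigit p x r = 0) (n : ℕ) :
    p ^ m ∣ truncVal p x n :=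
  Finset.dvd_sum fun r _ => by
    rcases lt_or_ge r m with hr | hr
    · simp [hx r hr]
    · exact (pow_dvd_pow p hr).mul_left _

lemma truncVal_div_pow_add {p : ℕ} (hp : 0 < p) (m b : ℕ) {δ : ℝ}
    (hδ₀ : 0 ≤ δ) (hδ : δ < ((p : ℝ) ^ m)⁻¹) (n : ℕ) :
    truncVal p ((b : ℝ) / (p : ℝ) ^ m + δ) n
      = truncVal p ((b : ℝ) / (p : ℝ) ^ m) n + truncVal p δ n := by
  simp only [truncVal, ← Finset.sum_add_distrib, ← add_mul, rdigit_div_pow_add hp m b hδ₀ hδ]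

lemma rdigit_single_of_lt {p y m r : ℕ} (hy : y < p) (hr : r < m) :
    rdigit p ((y : ℝ) / (p : ℝ) ^ (m + 1)) r = 0 := by
  obtain ⟨k, hk⟩ := Nat.exists_eq_add_of_le (Nat.succ_le_of_lt hr)
  rw [rdigit_div_pow_of_lt (k := k + 1) (by omega) (by omega), Nat.div_eq_of_lt, Nat.zero_mod]
  exact hy.trans_le (Nat.le_self_pow (by omega) p)

lemma truncVal_single {p y m n : ℕ} (hy : y < p) (hn : m < n) :
    truncVal p ((y : ℝ) / (p : ℝ) ^ (m + 1)) n = y * p ^ m := by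
  have hp : 0 < p := by omega
  rw [truncVal_eq_of_le (fun r hr => rdigit_div_pow_of_le hp hr y) (Nat.succ_le_of_lt hn),
    truncVal_succ, truncVal_eq_zero fun r hr => rdigit_single_of_lt hy hr,
    rdigit_div_pow_of_lt (k := 0) hp rfl, pow_zero, Nat.div_one, Nat.mod_eq_of_lt hy, zero_add]

lemma sdigit_eq (p : ℕ) (x σ : ℝ) (r : ℕ) :
    sdigit p x σ r = (truncVal p x (r + 1) + truncVal p σ (r + 1)) / p ^ r % p := by
  rw [sdigit, pow_succ, Nat.mod_mul_right_div_self]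

lemma sdigit_lt {p : ℕ} (hp : 0 < p) (x σ : ℝ) (r : ℕ) : sdigit p x σ r < p := by
  rw [sdigit_eq]
  exact Nat.mod_lt _ hp

lemma sum_digits_le {p : ℕ} (hp : 0 < p) {d : ℕ → ℕ} (hd : ∀ r, d r < p) (m : ℕ) :
    ∑ r ∈ Finset.range m, (d r : ℝ) / (p : ℝ) ^ (r + 1) ≤ 1 - ((p : ℝ) ^ m)⁻¹ := by
  have hpR : (0 : ℝ) < p := by exact_mod_cast hp
  induction m with
  | zero => simp
  | succ m ih =>
    rw [Finset.sum_range_succ]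
    have hdm : (d m : ℝ) + 1 ≤ p := by exact_mod_cast hd m
    have hterm : (d m : ℝ) / (p : ℝ) ^ (m + 1) ≤ ((p : ℝ) ^ m)⁻¹ - ((p : ℝ) ^ (m + 1))⁻¹ := by
      have heq : ((p : ℝ) ^ m)⁻¹ - ((p : ℝ) ^ (m + 1))⁻¹ = ((p : ℝ) - 1) / (p : ℝ) ^ (m + 1) := by
        rw [pow_succ]
        field_simp
      rw [heq]
      gcongr
      linarith
    linarith

lemma hasSum_pred_div_pow {p : ℕ} (hp : 1 < p) (m : ℕ) :
    HasSum (fun k : ℕ => ((p : ℝ) - 1) / (p : ℝ) ^ (k + m + 1)) (((p : ℝ) ^ m)⁻¹) := by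
  have hpR : (1 : ℝ) < p := by exact_mod_cast hp
  have hp1 : (p : ℝ) - 1 ≠ 0 := by linarith
  have hgeo := (hasSum_geometric_of_lt_one (r := (p : ℝ)⁻¹) (by positivity)
    (inv_lt_one_of_one_lt₀ hpR)).mul_left (((p : ℝ) - 1) / (p : ℝ) ^ (m + 1))
  have hterm : (fun k : ℕ => ((p : ℝ) - 1) / (p : ℝ) ^ (k + m + 1))
      = fun k => ((p : ℝ) - 1) / (p : ℝ) ^ (m + 1) * (p : ℝ)⁻¹ ^ k := by
    ext k
    rw [add_assoc, pow_add _ k, inv_pow]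
    field_simp
  have hval : ((p : ℝ) ^ m)⁻¹ = ((p : ℝ) - 1) / (p : ℝ) ^ (m + 1) * (1 - (p : ℝ)⁻¹)⁻¹ := by
    have : (1 : ℝ) - (p : ℝ)⁻¹ = ((p : ℝ) - 1) / p := by field_simp
    rw [this, pow_succ]
    field_simp
  rwa [hterm, hval]

lemma summable_digits {p : ℕ} (hp : 1 < p) {d : ℕ → ℕ} (hd : ∀ r, d r < p) :
    Summable fun r : ℕ => (d r : ℝ) / (p : ℝ) ^ (r + 1) := by
  refine Summable.of_nonneg_of_le (fun r => by positivity) (fun r => ?_)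
    (hasSum_pred_div_pow hp 0).summable
  have hdr : (d r : ℝ) + 1 ≤ p := by exact_mod_cast hd r
  rw [add_zero]
  gcongr
  linarith

/-- A digit tail starting at position `m` that is not constantly `p - 1` has value less than
`p^{-m}`. -/
lemma tsum_digits_tail_lt {p : ℕ} (hp : 1 < p) {d : ℕ → ℕ} (hd : ∀ r, d r < p) {m : ℕ}
    (hne : ∃ r, m ≤ r ∧ d r ≠ p - 1) :
    ∑' k : ℕ, (d (k + m) : ℝ) / (p : ℝ) ^ (k + m + 1) < ((p : ℝ) ^ m)⁻¹ := by
  have hpR : (1 : ℝ) < p := by exact_mod_cast hp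
  obtain ⟨r, hr, hdr⟩ := hne
  obtain ⟨k, rfl⟩ := Nat.exists_eq_add_of_le' hr
  have hgeo := hasSum_pred_div_pow hp m
  rw [← hgeo.tsum_eq]
  refine Summable.tsum_lt_tsum (i := k) (fun j => ?_) ?_
    ((summable_nat_add_iff m).mpr (summable_digits hp hd)) hgeo.summable
  · have : (d (j + m) : ℝ) + 1 ≤ p := by exact_mod_cast hd (j + m)
    dsimp only
    gcongr
    linarith
  · have hlt : d (k + m) + 1 < p := by
      have := hd (k + m)
      omega
    have : (d (k + m) : ℝ) + 1 < p := by exact_mod_cast hlt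
    gcongr
    linarith

/-- Adding a carry `y ≤ 1` at position `m` to the digits of `δ < p^{-m}` does not produce
an infinite run of `p - 1`. -/
lemma exists_sdigit_single_ne_pred {p y m : ℕ} (hp : 1 < p) (hy : y ≤ 1) {δ : ℝ}
    (hδ₀ : 0 ≤ δ) (hδ : δ < ((p : ℝ) ^ m)⁻¹) :
    ∃ r, m ≤ r ∧ sdigit p ((y : ℝ) / (p : ℝ) ^ (m + 1)) δ r ≠ p - 1 := by
  by_contra! hall
  have hp0 : 0 < p := by omega
  have hδdig : ∀ r, r < m → rdigit p δ r = 0 := fun r hr => rdigit_of_lt_inv_pow hp0 hr hδ₀ hδ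
  have hmod : ∀ n, m ≤ n → (y * p ^ m + truncVal p δ n) % p ^ n + p ^ m = p ^ n := by
    intro n hn
    induction n, hn using Nat.le_induction with
    | base => simp [truncVal_eq_zero hδdig]
    | succ n hn ih =>
      have hdig := hall n hn
      rw [sdigit_eq, truncVal_single (by omega) (by omega)] at hdig
      have hlow : (y * p ^ m + truncVal p δ (n + 1)) % p ^ n
          = (y * p ^ m + truncVal p δ n) % p ^ n := by
        rw [truncVal_succ, ← add_assoc, Nat.add_mul_mod_self_right]
      rw [Nat.mod_pow_succ, hdig, hlow]
      obtain ⟨q, rfl⟩ := Nat.exists_eq_add_of_lt hp0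
      simp only [zero_add, Nat.add_sub_cancel] at ih ⊢
      rw [pow_succ]
      linarith
  have htrunc : ∀ n, m < n → (y + 1) * p ^ m + truncVal p δ n = p ^ n := by
    intro n hn
    have hpow : p ^ m < p ^ n := Nat.pow_lt_pow_right hp hn
    have hm := hmod n hn.le
    have hle : truncVal p δ n + p ^ m ≤ p ^ n := by
      obtain ⟨c, hc⟩ := pow_dvd_truncVal hδdig n
      obtain ⟨k, rfl⟩ := Nat.exists_eq_add_of_lt hn
      have hlt := truncVal_lt hp0 δ (m + k + 1)
      rw [hc, add_assoc, pow_add] at hlt ⊢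
      have := Nat.lt_of_mul_lt_mul_left hlt
      nlinarith [Nat.mul_le_mul_left (p ^ m) (Nat.succ_le_of_lt this)]
    have hle' : y * p ^ m ≤ p ^ m := by simpa using Nat.mul_le_mul_right (p ^ m) hy
    rcases (show y * p ^ m + truncVal p δ n ≤ p ^ n by omega).eq_or_lt with heq | hlt
    · rw [heq, Nat.mod_self] at hm
      omega
    · rw [Nat.mod_eq_of_lt hlt] at hm
      linarith
  obtain ⟨r, hr, hne⟩ := exists_rdigit_ne_pred hp hδ₀ (m + 1)
  refine hne ?_
  have h₁ := htrunc r (by omega)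
  have h₂ := htrunc (r + 1) (by omega)
  rw [truncVal_succ, ← add_assoc, h₁, pow_succ] at h₂
  have h₃ : (rdigit p δ r + 1) * p ^ r = p * p ^ r := by linarith
  have := Nat.eq_of_mul_eq_mul_right (by positivity) h₃
  omega

lemma sdigit_single_of_lt {p y m r : ℕ} (hy : y < p) {δ : ℝ}
    (hδ₀ : 0 ≤ δ) (hδ : δ < ((p : ℝ) ^ m)⁻¹) (hr : r < m) :
    sdigit p ((y : ℝ) / (p : ℝ) ^ (m + 1)) δ r = 0 := by
  have hp : 0 < p := by omega
  rw [sdigit_eq, truncVal_eq_zero fun s hs => rdigit_single_of_lt hy (by omega),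
    truncVal_eq_zero fun s hs => rdigit_of_lt_inv_pow hp (by omega) hδ₀ hδ]
  simp

/-- The carry digit at position `m` is the quotient of the integer sum by `p^m`. -/
lemma sdigit_carry {p : ℕ} (hp : 1 < p) (m a b : ℕ) :
    sdigit p ((a : ℝ) / (p : ℝ) ^ m) ((b : ℝ) / (p : ℝ) ^ m) m
        = (truncVal p ((a : ℝ) / (p : ℝ) ^ m) m + truncVal p ((b : ℝ) / (p : ℝ) ^ m) m) / p ^ m ∧
      sdigit p ((a : ℝ) / (p : ℝ) ^ m) ((b : ℝ) / (p : ℝ) ^ m) m ≤ 1 := by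
  have hp0 : 0 < p := by omega
  have ha := truncVal_lt hp0 ((a : ℝ) / (p : ℝ) ^ m) m
  have hb := truncVal_lt hp0 ((b : ℝ) / (p : ℝ) ^ m) m
  have hlt : (truncVal p ((a : ℝ) / (p : ℝ) ^ m) m
      + truncVal p ((b : ℝ) / (p : ℝ) ^ m) m) / p ^ m < 2 := by
    rw [Nat.div_lt_iff_lt_mul (by positivity)]
    omega
  rw [sdigit_eq, truncVal_eq_of_le (fun r hr => rdigit_div_pow_of_le hp0 hr a) m.le_succ,
    truncVal_eq_of_le (fun r hr => rdigit_div_pow_of_le hp0 hr b) m.le_succ,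
    Nat.mod_eq_of_lt (hlt.trans_le hp)]
  exact ⟨rfl, by omega⟩

lemma sdigit_add_of_lt {p : ℕ} (hp : 0 < p) (x : ℝ) {m r : ℕ} (b : ℕ) {δ : ℝ}
    (hδ₀ : 0 ≤ δ) (hδ : δ < ((p : ℝ) ^ m)⁻¹) (hr : r < m) :
    sdigit p x ((b : ℝ) / (p : ℝ) ^ m + δ) r = sdigit p x ((b : ℝ) / (p : ℝ) ^ m) r := by
  rw [sdigit, sdigit, truncVal_div_pow_add hp m b hδ₀ hδ,
    truncVal_eq_zero (x := δ) fun s hs => rdigit_of_lt_inv_pow hp (by omega) hδ₀ hδ, add_zero]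

lemma sdigit_add_of_le {p : ℕ} (hp : 1 < p) {m r : ℕ} (a b : ℕ) {δ : ℝ}
    (hδ₀ : 0 ≤ δ) (hδ : δ < ((p : ℝ) ^ m)⁻¹) (hr : m ≤ r) :
    sdigit p ((a : ℝ) / (p : ℝ) ^ m) ((b : ℝ) / (p : ℝ) ^ m + δ) r
      = sdigit p ((sdigit p ((a : ℝ) / (p : ℝ) ^ m) ((b : ℝ) / (p : ℝ) ^ m) m : ℝ)
          / (p : ℝ) ^ (m + 1)) δ r := by
  have hp0 : 0 < p := by omega
  obtain ⟨hcarry, hle⟩ := sdigit_carry hp m a b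
  rw [sdigit_eq, sdigit_eq p _ δ, truncVal_div_pow_add hp0 m b hδ₀ hδ,
    truncVal_single (by omega) (by omega), hcarry,
    truncVal_eq_of_le (fun r hr => rdigit_div_pow_of_le hp0 hr a) (hr.trans r.le_succ),
    truncVal_eq_of_le (fun r hr => rdigit_div_pow_of_le hp0 hr b) (hr.trans r.le_succ),
    ← add_assoc]
  obtain ⟨c, hc⟩ := pow_dvd_truncVal
    (fun r hr => rdigit_of_lt_inv_pow hp0 hr hδ₀ hδ : ∀ r, r < m → rdigit p δ r = 0) (r + 1)
  obtain ⟨k, rfl⟩ := Nat.exists_eq_add_of_le hr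
  have hpos : 0 < p ^ m := by positivity
  rw [hc, pow_add, ← Nat.div_div_eq_div_mul, ← Nat.div_div_eq_div_mul,
    Nat.add_mul_div_left _ _ hpos, Nat.add_mul_div_left _ _ hpos, Nat.mul_div_cancel _ hpos]

/-- If the digits of `x ⊕_p σ` from position `m` on are not all `p - 1`, the reduction mod 1 in
`pshift` is vacuous and the shift splits into its `m`-digit truncation and the remaining tail. -/
lemma pshift_eq_simpShift_add_tsum {p : ℕ} (hp : 1 < p) {m : ℕ} {x σ : ℝ}
    (hne : ∃ r, m ≤ r ∧ sdigit p x σ r ≠ p - 1) :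
    pshift p x σ = simpShift p m x σ
      + ∑' k : ℕ, (sdigit p x σ (k + m) : ℝ) / (p : ℝ) ^ (k + m + 1) := by
  have hd := sdigit_lt (by omega : 0 < p) x σ
  have hT0 : 0 ≤ ∑' k : ℕ, (sdigit p x σ (k + m) : ℝ) / (p : ℝ) ^ (k + m + 1) :=
    tsum_nonneg fun k => by positivity
  have hT1 := tsum_digits_tail_lt hp hd hne
  have hS0 : 0 ≤ simpShift p m x σ := Finset.sum_nonneg fun r _ => by positivity
  have hS1 : simpShift p m x σ ≤ 1 - ((p : ℝ) ^ m)⁻¹ := sum_digits_le (by omega) hd m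
  have hsplit := (summable_digits hp hd).sum_add_tsum_nat_add m
  rw [pshift, ← hsplit]
  exact Int.fract_eq_self.mpr ⟨add_nonneg hS0 hT0, (add_lt_add_of_le_of_lt hS1 hT1).trans_eq
    (sub_add_cancel _ _)⟩

/-- the decomposition `h ⊕_p (σ_m + δ) = (h ⊕_{p,m}^{simp} σ_m) + (ξ ⊕_p δ)`,
where `ξ = ξ(h,σ_m) = y_{m+1} p^{-(m+1)}` is built from the carry digit `y_{m+1}` of the
`p`-adic sum `φ_p^+(h) + φ_p^+(σ_m)`; moreover `ξ` and `ξ ⊕_p δ` lie in `[0, p^{-m})`. -/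
theorem pshift_decomposition
    (p : ℕ) (hp : p.Prime) (m : ℕ) (hm : 0 < m)
    (h σm : ℝ) (hh : QSet p m h) (hσ : QSet p m σm)
    (δ : ℝ) (hδ : δ ∈ Set.Ico (0 : ℝ) (((p : ℝ) ^ m)⁻¹)) :
    pshift p h (σm + δ) =
        simpShift p m h σm + pshift p ((sdigit p h σm m : ℝ) / (p : ℝ) ^ (m + 1)) δ ∧
      (sdigit p h σm m : ℝ) / (p : ℝ) ^ (m + 1) ∈ Set.Ico (0 : ℝ) (((p : ℝ) ^ m)⁻¹) ∧
      pshift p ((sdigit p h σm m : ℝ) / (p : ℝ) ^ (m + 1)) δ ∈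
        Set.Ico (0 : ℝ) (((p : ℝ) ^ m)⁻¹) := by
  obtain ⟨a, -, rfl⟩ := hh
  obtain ⟨b, -, rfl⟩ := hσ
  obtain ⟨hδ₀, hδ⟩ := hδ
  have hp1 := hp.one_lt
  have hp0 := hp.pos
  have hpR : (1 : ℝ) < p := by exact_mod_cast hp1
  have hy := (sdigit_carry hp1 m a b).2
  have htail := fun r (hr : m ≤ r) => sdigit_add_of_le hp1 a b hδ₀ hδ hr
  have hhead := fun r (hr : r < m) =>
    sdigit_add_of_lt hp0 ((a : ℝ) / (p : ℝ) ^ m) b hδ₀ hδ hr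
  set y := sdigit p ((a : ℝ) / (p : ℝ) ^ m) ((b : ℝ) / (p : ℝ) ^ m) m
  set ξ : ℝ := (y : ℝ) / (p : ℝ) ^ (m + 1) with hξ
  have hne : ∃ r, m ≤ r ∧ sdigit p ξ δ r ≠ p - 1 := exists_sdigit_single_ne_pred hp1 hy hδ₀ hδ
  set T : ℝ := ∑' k : ℕ, (sdigit p ξ δ (k + m) : ℝ) / (p : ℝ) ^ (k + m + 1) with hT
  have hT0 : 0 ≤ T := tsum_nonneg fun k => by positivity
  have hT1 : T < ((p : ℝ) ^ m)⁻¹ :=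
    tsum_digits_tail_lt hp1 (sdigit_lt hp0 ξ δ) hne
  have hξshift : pshift p ξ δ = T := by
    rw [pshift_eq_simpShift_add_tsum hp1 hne, simpShift, Finset.sum_eq_zero, zero_add]
    intro r hr
    rw [hξ, sdigit_single_of_lt (by omega) hδ₀ hδ (Finset.mem_range.mp hr)]
    simp
  refine ⟨?_, ⟨by positivity, ?_⟩, ?_⟩
  · have hne' : ∃ r, m ≤ r ∧
        sdigit p ((a : ℝ) / (p : ℝ) ^ m) ((b : ℝ) / (p : ℝ) ^ m + δ) r ≠ p - 1 := by
      obtain ⟨r, hr, hdr⟩ := hne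
      exact ⟨r, hr, by rwa [htail r hr]⟩
    rw [hξshift, pshift_eq_simpShift_add_tsum hp1 hne', simpShift, simpShift]
    congr 1
    · exact Finset.sum_congr rfl fun r hr => by rw [hhead r (Finset.mem_range.mp hr)]
    · exact tsum_congr fun k => by rw [htail (k + m) (Nat.le_add_left m k)]
  · have hyp : (y : ℝ) < p := by exact_mod_cast hy.trans_lt hp1
    rw [hξ, div_lt_iff₀ (by positivity), pow_succ, inv_mul_cancel_left₀ (by positivity)]
    exact hyp
  · rw [hξshift]
    exact ⟨hT0, hT1⟩
end
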